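/- Local inclusion of anisotropic Hölder space into kinetic Hölder space (Corollary 1.8(ii)). Let d ≥ 1, α ∈ (0,1), R > 0, and let u ∈ ℂ^{2,α}(Q_R). Then for every r ∈ (0,R), u ∈ kC^{2,α}(Q_r) and [D²_v u]_{kC^α(Q_r)} ≤ N(d,α,r,R) ‖u‖_{ℂ^{2,α}(Q_R)}, where ‖u‖_{ℂ^{2,α}(Q_R)} := ‖u‖ + ‖D_v u‖ + ‖D²_v u‖ + ‖∂_t u − v·D_x u‖ with ‖·‖ denoting the L∞C^{α/3,α}_{x,v}(Q_R) norm. -/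

import Mathlib

open MeasureTheory ENNReal Set

noncomputable section

/-- Euclidean space `ℝ^d`. -/
abbrev Ed (d : ℕ) : Type := EuclideanSpace ℝ (Fin d)

/-- Points `z = (t, x, v) ∈ ℝ × ℝ^d × ℝ^d`. -/
abbrev Pt (d : ℕ) : Type := ℝ × Ed d × Ed d

/-- The kinetic quasi-distance `ρ(z, z₀)`. -/
def kRho {d : ℕ} (z z0 : Pt d) : ℝ :=
  max (|z.1 - z0.1| ^ ((1 : ℝ)/2))
    (max (‖z.2.1 - z0.2.1 + (z.1 - z0.1) • z0.2.2‖ ^ ((1 : ℝ)/3)) ‖z.2.2 - z0.2.2‖)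

/-- The kinetic Hölder seminorm `[u]_{kC^α(G)}` (extended-real valued). -/
def kSemi {d : ℕ} {F : Type*} [NormedAddCommGroup F] (α : ℝ) (G : Set (Pt d))
    (u : Pt d → F) : ℝ≥0∞ :=
  ⨆ (z : Pt d) (_ : z ∈ G) (z' : Pt d) (_ : z' ∈ G) (_ : z ≠ z'),
    ENNReal.ofReal (‖u z - u z'‖ / kRho z z' ^ α)

/-- The sup (`L_∞`) norm over `G`, extended-real valued. -/
def supNorm {d : ℕ} {F : Type*} [NormedAddCommGroup F] (G : Set (Pt d))
    (u : Pt d → F) : ℝ≥0∞ :=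
  ⨆ (z : Pt d) (_ : z ∈ G), (‖u z‖₊ : ℝ≥0∞)

/-- Anisotropic Hölder seminorm `[w]_{C^{α/3,α}_{x,v}(D)}`. -/
def anisoSemi {d : ℕ} {F : Type*} [NormedAddCommGroup F] (α : ℝ) (D : Set (Ed d × Ed d))
    (w : Ed d × Ed d → F) : ℝ≥0∞ :=
  ⨆ (p : Ed d × Ed d) (_ : p ∈ D) (q : Ed d × Ed d) (_ : q ∈ D) (_ : p ≠ q),
    ENNReal.ofReal (‖w p - w q‖ / (‖p.1 - q.1‖ ^ ((1 : ℝ)/3) + ‖p.2 - q.2‖) ^ α)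

/-- The `L_∞ C^{α/3,α}_{x,v}` seminorm over `I × D`. -/
def lixvSemi {d : ℕ} {F : Type*} [NormedAddCommGroup F] (α : ℝ) (I : Set ℝ)
    (D : Set (Ed d × Ed d)) (u : Pt d → F) : ℝ≥0∞ :=
  ⨆ (t : ℝ) (_ : t ∈ I), anisoSemi α D (fun p => u (t, p.1, p.2))

/-- The time interval `(−∞, T)` for `T ∈ (−∞, ∞]`. -/
def slabI (T : EReal) : Set ℝ := {t : ℝ | (t : EReal) < T}

/-- The set `ℝ^{1+2d}_T = (−∞,T) × ℝ^{2d}`. -/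
def slabG (d : ℕ) (T : EReal) : Set (Pt d) := slabI T ×ˢ (Set.univ : Set (Ed d × Ed d))

/-- Classical time derivative `∂_t u`. -/
def Dt {d : ℕ} (u : Pt d → ℝ) (z : Pt d) : ℝ := deriv (fun s => u (s, z.2.1, z.2.2)) z.1

/-- Classical spatial gradient `D_x u`. -/
def Dx {d : ℕ} (u : Pt d → ℝ) (z : Pt d) : Ed d →L[ℝ] ℝ :=
  fderiv ℝ (fun y => u (z.1, y, z.2.2)) z.2.1

/-- Classical velocity gradient `D_v u`. -/
def Dv {d : ℕ} (u : Pt d → ℝ) (z : Pt d) : Ed d →L[ℝ] ℝ :=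
  fderiv ℝ (fun w => u (z.1, z.2.1, w)) z.2.2

/-- Classical velocity Hessian `D²_v u`. -/
def Dvv {d : ℕ} (u : Pt d → ℝ) (z : Pt d) : Ed d →L[ℝ] Ed d →L[ℝ] ℝ :=
  fderiv ℝ (fun w => Dv u (z.1, z.2.1, w)) z.2.2

/-- Transport term `Y u = ∂_t u − v · D_x u`. -/
def Yop {d : ℕ} (u : Pt d → ℝ) (z : Pt d) : ℝ := Dt u z - Dx u z z.2.2

/-- Contraction `a^{ij} B_{ij}`. -/
def contr2 {d : ℕ} (A : Matrix (Fin d) (Fin d) ℝ) (B : Ed d →L[ℝ] Ed d →L[ℝ] ℝ) : ℝ :=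
  ∑ i, ∑ j, A i j * B (EuclideanSpace.single i 1) (EuclideanSpace.single j 1)

/-- KFP operator `P u = ∂_t u − v·D_x u − a^{ij}(z) D_{v_iv_j} u`. -/
def Pop {d : ℕ} (a : Pt d → Matrix (Fin d) (Fin d) ℝ) (u : Pt d → ℝ) (z : Pt d) : ℝ :=
  Yop u z - contr2 (a z) (Dvv u z)

/-- Model KFP operator with `a = a(t)`. -/
def P0op {d : ℕ} (a : ℝ → Matrix (Fin d) (Fin d) ℝ) (u : Pt d → ℝ) (z : Pt d) : ℝ :=
  Yop u z - contr2 (a z.1) (Dvv u z)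

/-- Laplacian in the velocity variable `Δ_v u`. -/
def lapV {d : ℕ} (u : Pt d → ℝ) (z : Pt d) : ℝ :=
  ∑ i, Dvv u z (EuclideanSpace.single i 1) (EuclideanSpace.single i 1)

/-- Fractional Laplacian `(−Δ_x)^{1/3} u`, pointwise integral formula with constant `cd`. -/
def fracLap {d : ℕ} (cd : ℝ) (u : Pt d → ℝ) (z : Pt d) : ℝ :=
  cd * ∫ y : Ed d, (u z - u (z.1, z.2.1 + y, z.2.2)) / ‖y‖ ^ ((d : ℝ) + 2/3)

/-- Hölder seminorm in `x` of a function on `ℝ^d`. -/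
def xSemi {d : ℕ} (β : ℝ) (w : Ed d → ℝ) : ℝ≥0∞ :=
  ⨆ (x : Ed d) (x' : Ed d) (_ : x ≠ x'), ENNReal.ofReal (|w x - w x'| / ‖x - x'‖ ^ β)

/-- `sup_{t ∈ I, v} [u(t,·,v)]_{C^β(ℝ^d)}`. -/
def supXSemi {d : ℕ} (β : ℝ) (I : Set ℝ) (u : Pt d → ℝ) : ℝ≥0∞ :=
  ⨆ (t : ℝ) (_ : t ∈ I) (v : Ed d), xSemi β (fun x => u (t, x, v))

/-- Hölder norm in `x` over a set `A ⊂ ℝ^d`. -/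
def xHolderNorm {d : ℕ} (β : ℝ) (A : Set (Ed d)) (w : Ed d → ℝ) : ℝ≥0∞ :=
  (⨆ (x : Ed d) (_ : x ∈ A), ENNReal.ofReal |w x|) +
    ⨆ (x : Ed d) (_ : x ∈ A) (x' : Ed d) (_ : x' ∈ A) (_ : x ≠ x'),
      ENNReal.ofReal (|w x - w x'| / ‖x - x'‖ ^ β)

/-- Kinetic cylinder `Q_{r,s}(z₀)` (`v`-radius `r`, `x`-radius `s³`). -/
def kCyl {d : ℕ} (r s : ℝ) (z0 : Pt d) : Set (Pt d) :=
  {z : Pt d | z0.1 - r ^ 2 < z.1 ∧ z.1 < z0.1 ∧ ‖z.2.2 - z0.2.2‖ < r ∧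
    ‖z.2.1 - z0.2.1 + (z.1 - z0.1) • z0.2.2‖ < s ^ 3}

/-- Kinetic cylinder `Q_r(z₀)`. -/
def kQ {d : ℕ} (r : ℝ) (z0 : Pt d) : Set (Pt d) := kCyl r r z0

/-- The origin of `ℝ^{1+2d}`. -/
def ptO (d : ℕ) : Pt d := (0, 0, 0)

/-- Mean-square average `(|g|²)^{1/2}_A`. -/
def msq {d : ℕ} {F : Type*} [NormedAddCommGroup F] (A : Set (Pt d)) (g : Pt d → F) : ℝ :=
  Real.sqrt (⨍ z in A, ‖g z‖ ^ 2)

/-- Average `(g)_A`. -/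
def avg {d : ℕ} {F : Type*} [NormedAddCommGroup F] [NormedSpace ℝ F] (A : Set (Pt d))
    (g : Pt d → F) : F :=
  ⨍ z in A, g z

/-- Mean-square oscillation `(|g − (g)_A|²)^{1/2}_A`. -/
def oscL2 {d : ℕ} {F : Type*} [NormedAddCommGroup F] [NormedSpace ℝ F] (A : Set (Pt d))
    (g : Pt d → F) : ℝ :=
  msq A (fun z => g z - avg A g)

/-- `L²` norm over `A`. -/
def l2 {d : ℕ} {F : Type*} [NormedAddCommGroup F] (A : Set (Pt d)) (g : Pt d → F) : ℝ :=
  Real.sqrt (∫ z in A, ‖g z‖ ^ 2)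

/-- Membership in the kinetic Hölder space `kC^{2,α}(I × D)`:
`u ∈ kC^α`, the classical derivatives `D_v u`, `D²_v u`, `Y u` exist,
`Y u ∈ L_∞ C^{α/3,α}_{x,v}` and `[D²_v u]_{kC^α} < ∞`. -/
def kC2mem {d : ℕ} (α : ℝ) (I : Set ℝ) (D : Set (Ed d × Ed d)) (u : Pt d → ℝ) : Prop :=
  supNorm (I ×ˢ D) u < ⊤ ∧ kSemi α (I ×ˢ D) u < ⊤ ∧
  (∀ z ∈ I ×ˢ D, DifferentiableAt ℝ (fun s => u (s, z.2.1, z.2.2)) z.1) ∧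
  (∀ z ∈ I ×ˢ D, DifferentiableAt ℝ (fun y => u (z.1, y, z.2.2)) z.2.1) ∧
  (∀ z ∈ I ×ˢ D, DifferentiableAt ℝ (fun w => u (z.1, z.2.1, w)) z.2.2) ∧
  (∀ z ∈ I ×ˢ D, DifferentiableAt ℝ (fun w => Dv u (z.1, z.2.1, w)) z.2.2) ∧
  supNorm (I ×ˢ D) (Yop u) < ⊤ ∧
  lixvSemi α I D (Yop u) < ⊤ ∧
  kSemi α (I ×ˢ D) (Dvv u) < ⊤

/-- Membership in the anisotropic Hölder space `ℂ^{2,α}(I × D)`: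
the classical derivatives `D_v u`, `D²_v u`, `Y u` exist and
`u, D_v u, D²_v u, Y u ∈ L_∞ C^{α/3,α}_{x,v}(I × D)`. -/
def C2mem {d : ℕ} (α : ℝ) (I : Set ℝ) (D : Set (Ed d × Ed d)) (u : Pt d → ℝ) : Prop :=
  (∀ z ∈ I ×ˢ D, DifferentiableAt ℝ (fun s => u (s, z.2.1, z.2.2)) z.1) ∧
  (∀ z ∈ I ×ˢ D, DifferentiableAt ℝ (fun y => u (z.1, y, z.2.2)) z.2.1) ∧
  (∀ z ∈ I ×ˢ D, DifferentiableAt ℝ (fun w => u (z.1, z.2.1, w)) z.2.2) ∧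
  (∀ z ∈ I ×ˢ D, DifferentiableAt ℝ (fun w => Dv u (z.1, z.2.1, w)) z.2.2) ∧
  supNorm (I ×ˢ D) u < ⊤ ∧ lixvSemi α I D u < ⊤ ∧
  supNorm (I ×ˢ D) (Dv u) < ⊤ ∧ lixvSemi α I D (Dv u) < ⊤ ∧
  supNorm (I ×ˢ D) (Dvv u) < ⊤ ∧ lixvSemi α I D (Dvv u) < ⊤ ∧
  supNorm (I ×ˢ D) (Yop u) < ⊤ ∧ lixvSemi α I D (Yop u) < ⊤

/-- Ellipticity and boundedness of a coefficient matrix: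
`a^{ij} ξ_i ξ_j ≥ δ|ξ|²` and `|a| ≤ δ⁻¹`. -/
def elliptic {d : ℕ} (δ : ℝ) (A : Matrix (Fin d) (Fin d) ℝ) : Prop :=
  (∀ ξ : Ed d, δ * ‖ξ‖ ^ 2 ≤ ∑ i, ∑ j, A i j * ξ i * ξ j) ∧ (∀ i j, |A i j| ≤ δ⁻¹)

/-- Iterated classical mixed derivative `D_v^m D_x^l u`. -/
def Dmix {d : ℕ} (l m : ℕ) (u : Pt d → ℝ) (z : Pt d) :
    ContinuousMultilinearMap ℝ (fun _ : Fin m => Ed d)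
      (ContinuousMultilinearMap ℝ (fun _ : Fin l => Ed d) ℝ) :=
  iteratedFDeriv ℝ m (fun w => iteratedFDeriv ℝ l (fun y => u (z.1, y, w)) z.2.1) z.2.2

/-- Time derivative of the mixed derivative: `∂_t D_x^l D_v^m u`. -/
def DtMix {d : ℕ} (l m : ℕ) (u : Pt d → ℝ) (z : Pt d) :
    ContinuousMultilinearMap ℝ (fun _ : Fin m => Ed d)
      (ContinuousMultilinearMap ℝ (fun _ : Fin l => Ed d) ℝ) :=
  deriv (fun s => Dmix l m u (s, z.2.1, z.2.2)) z.1

/-- `∂_t` for functions of `(t,v)`. -/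
def Dt2 {d : ℕ} (w : ℝ × Ed d → ℝ) (t : ℝ) (v : Ed d) : ℝ := deriv (fun s => w (s, v)) t

/-- `D_v` for functions of `(t,v)`. -/
def Dv2 {d : ℕ} (w : ℝ × Ed d → ℝ) (t : ℝ) (v : Ed d) : Ed d →L[ℝ] ℝ :=
  fderiv ℝ (fun y => w (t, y)) v

/-- `D²_v` for functions of `(t,v)`. -/
def Dvv2 {d : ℕ} (w : ℝ × Ed d → ℝ) (t : ℝ) (v : Ed d) : Ed d →L[ℝ] Ed d →L[ℝ] ℝ :=
  fderiv ℝ (fun y => Dv2 w t y) v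

/-- The kinetic scaling `z ↦ z̃ = (r²t + t₀, r³x + x₀ − r²t v₀, rv + v₀)`. -/
def kScale {d : ℕ} (r : ℝ) (z0 z : Pt d) : Pt d :=
  (r ^ 2 * z.1 + z0.1, (r ^ 3) • z.2.1 + z0.2.1 - (r ^ 2 * z.1) • z0.2.2, r • z.2.2 + z0.2.2)

/-- Kinetic Campanato seminorm. -/
def campSemi {d : ℕ} (α : ℝ) (T : EReal) (u : Pt d → ℝ) : ℝ≥0∞ :=
  ⨆ (r : ℝ) (_ : 0 < r) (z0 : Pt d) (_ : (z0.1 : EReal) ≤ T),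
    ENNReal.ofReal (oscL2 (kQ r z0) u / r ^ α)

end

/-- A function that is maximal at the right end point of an interval has a nonnegative derivative
there. -/
theorem hasDerivAt_nonneg_of_forall_le {f : ℝ → ℝ} {f' τ : ℝ} (hτ : 0 < τ)
    (hf : HasDerivAt f f' τ) (hmax : ∀ s ∈ Set.Icc 0 τ, f s ≤ f τ) : 0 ≤ f' := by
  have h1 : Filter.Tendsto (slope f τ) (nhdsWithin τ (Set.Iio τ)) (nhds f') :=
    (hasDerivAt_iff_tendsto_slope.1 hf).mono_left
      (nhdsWithin_mono _ fun s (hs : s < τ) => hs.ne)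
  refine ge_of_tendsto h1 ?_
  filter_upwards [Ioo_mem_nhdsLT hτ] with s hs
  rw [slope_def_field]
  exact div_nonneg_of_nonpos (sub_nonpos.2 (hmax s ⟨hs.1.le, hs.2.le⟩)) (by linarith [hs.2])

/-- A continuous function with separate partial derivatives whose sum is at most `B` grows at most
at rate `B` along the diagonal. No joint differentiability is needed: the penalised function
`w - B' τ - K (τ - σ)²` is maximised. -/
theorem diag_sub_le {w a b : ℝ → ℝ → ℝ} {h θ B : ℝ} (hh : 0 < h) (hθ : 0 < θ)
    (hc : ContinuousOn (fun p : ℝ × ℝ => w p.1 p.2) (Set.Icc 0 h ×ˢ Set.Icc (-θ) (h + θ)))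
    (ha : ∀ τ ∈ Set.Ioc 0 h, ∀ σ ∈ Set.Icc (-θ) (h + θ),
      HasDerivAt (fun s => w s σ) (a τ σ) τ)
    (hb : ∀ τ ∈ Set.Ioc 0 h, ∀ σ ∈ Set.Icc (-θ) (h + θ),
      HasDerivAt (fun s => w τ s) (b τ σ) σ)
    (hab : ∀ τ ∈ Set.Ioc 0 h, ∀ σ ∈ Set.Icc (-θ) (h + θ), a τ σ + b τ σ ≤ B) :
    w h h - w 0 0 ≤ B * h := by
  refine le_of_forall_pos_le_add fun ε hε => ?_
  set B' := B + ε / (2 * h) with hB'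
  have hBB' : B < B' := by have : 0 < ε / (2 * h) := by positivity
                           linarith
  have hB'h : B' * h = B * h + ε / 2 := by rw [hB']; field_simp
  have hcpt : IsCompact (Set.Icc 0 h ×ˢ Set.Icc (-θ) (h + θ)) := isCompact_Icc.prod isCompact_Icc
  have h00 : ((0 : ℝ), (0 : ℝ)) ∈ Set.Icc 0 h ×ˢ Set.Icc (-θ) (h + θ) :=
    ⟨⟨le_rfl, hh.le⟩, by constructor <;> simp <;> linarith⟩
  have hhh : (h, h) ∈ Set.Icc 0 h ×ˢ Set.Icc (-θ) (h + θ) :=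
    ⟨⟨hh.le, le_rfl⟩, by constructor <;> simp <;> linarith⟩
  obtain ⟨M, hM⟩ := hcpt.exists_bound_of_continuousOn hc
  have hM0 : 0 ≤ M := (norm_nonneg _).trans (hM _ h00)
  obtain ⟨θ', hθ', hθ'θ, hw0⟩ : ∃ θ' > 0, θ' ≤ θ ∧ ∀ σ, |σ| < θ' → w 0 σ ≤ w 0 0 + ε / 2 := by
    obtain ⟨η, hη, hη'⟩ := Metric.continuousOn_iff.1 hc _ h00 (ε / 2) (by positivity)
    refine ⟨min η θ, lt_min hη hθ, min_le_right _ _, fun σ hσ => ?_⟩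
    have h1 : |σ| < θ := hσ.trans_le (min_le_right _ _)
    have h2 : |σ| < η := hσ.trans_le (min_le_left _ _)
    have h3 := hη' (0, σ) ⟨⟨le_rfl, hh.le⟩, by
      have := abs_lt.1 h1
      constructor <;> simp <;> linarith⟩ (by simpa [Prod.dist_eq, Real.dist_eq] using h2)
    rw [Real.dist_eq] at h3
    have := (abs_lt.1 h3).2
    simp only at this
    linarith
  set K := (2 * M + |B'| * h + 1) / θ' ^ 2 with hK
  have hK0 : 0 ≤ K := by positivity
  set ψ : ℝ × ℝ → ℝ := fun p => w p.1 p.2 - B' * p.1 - K * (p.1 - p.2) ^ 2 with hψ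
  have hψc : ContinuousOn ψ (Set.Icc 0 h ×ˢ Set.Icc (-θ) (h + θ)) :=
    (hc.sub (by fun_prop)).sub (by fun_prop)
  obtain ⟨⟨τ, σ⟩, ⟨hτ, hσ⟩, hmax⟩ := hcpt.exists_isMaxOn ⟨_, h00⟩ hψc
  simp only at hτ hσ
  have hmax' : ∀ s ∈ Set.Icc 0 h, ∀ r ∈ Set.Icc (-θ) (h + θ), ψ (s, r) ≤ ψ (τ, σ) :=
    fun s hs r hr => hmax (Set.mk_mem_prod hs hr)
  have hnear : |τ - σ| < θ' := by
    by_contra! hcon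
    have h1 : 2 * M + |B'| * h + 1 ≤ K * (τ - σ) ^ 2 := by
      rw [hK, div_mul_eq_mul_div, le_div_iff₀ (by positivity)]
      rw [← sq_abs (τ - σ)]
      gcongr
    have h2 := hmax' 0 h00.1 0 h00.2
    have h3 := abs_le.1 (hM _ h00)
    have h4 := abs_le.1 (hM (τ, σ) ⟨hτ, hσ⟩)
    have h5 : -(B' * τ) ≤ |B'| * h := by
      calc -(B' * τ) ≤ |B' * τ| := neg_le_abs _
        _ = |B'| * τ := by rw [abs_mul, abs_of_nonneg hτ.1]
        _ ≤ |B'| * h := by gcongr; exact hτ.2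
    simp only [hψ, mul_zero, sub_zero, sub_self] at h2
    simp only at h3 h4
    nlinarith
  have hnear' := abs_lt.1 hnear
  have hfin := hmax' h hhh.1 h hhh.2
  rcases hτ.1.eq_or_lt with h0 | hpos
  · subst h0
    have h1 := hw0 σ (by simpa using hnear)
    simp only [hψ, mul_zero, sub_zero, sub_self] at hfin
    nlinarith [mul_nonneg hK0 (sq_nonneg (0 - σ))]
  · exfalso
    have hda := ha τ ⟨hpos, hτ.2⟩ σ hσ
    have hdb := hb τ ⟨hpos, hτ.2⟩ σ hσ
    have hs := hab τ ⟨hpos, hτ.2⟩ σ hσ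
    have d1 : HasDerivAt (fun s => ψ (s, σ)) (a τ σ - B' - K * (2 * (τ - σ))) τ := by
      have e1 : HasDerivAt (fun s : ℝ => B' * s) B' τ := by
        simpa using (hasDerivAt_id τ).const_mul B'
      have e2 : HasDerivAt (fun s : ℝ => K * (s - σ) ^ 2) (K * (2 * (τ - σ))) τ := by
        simpa using (((hasDerivAt_id τ).sub_const σ).pow 2).const_mul K
      exact (hda.sub e1).sub e2
    have d2 : HasDerivAt (fun s => ψ (τ, s)) (b τ σ + K * (2 * (τ - σ))) σ := by
      have e2 : HasDerivAt (fun s : ℝ => K * (τ - s) ^ 2) (-(K * (2 * (τ - σ)))) σ := by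
        simpa using (((hasDerivAt_id σ).const_sub τ).pow 2).const_mul K
      have := (hdb.sub_const (B' * τ)).sub e2
      rwa [sub_neg_eq_add] at this
    have n1 := hasDerivAt_nonneg_of_forall_le hpos d1
      fun s hs => hmax' s ⟨hs.1, hs.2.trans hτ.2⟩ σ hσ
    have n2 : b τ σ + K * (2 * (τ - σ)) = 0 := by
      refine IsLocalMax.hasDerivAt_eq_zero ?_ d2
      filter_upwards [Icc_mem_nhds (show -θ < σ by linarith) (show σ < h + θ by linarith [hτ.2])]
        with s hs using hmax' τ hτ s hs
    linarith

/-- Two-sided version of `diag_sub_le`. -/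
theorem abs_diag_sub_le {w a b : ℝ → ℝ → ℝ} {h θ B : ℝ} (hh : 0 < h) (hθ : 0 < θ)
    (hc : ContinuousOn (fun p : ℝ × ℝ => w p.1 p.2) (Set.Icc 0 h ×ˢ Set.Icc (-θ) (h + θ)))
    (ha : ∀ τ ∈ Set.Ioc 0 h, ∀ σ ∈ Set.Icc (-θ) (h + θ),
      HasDerivAt (fun s => w s σ) (a τ σ) τ)
    (hb : ∀ τ ∈ Set.Ioc 0 h, ∀ σ ∈ Set.Icc (-θ) (h + θ),
      HasDerivAt (fun s => w τ s) (b τ σ) σ)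
    (hab : ∀ τ ∈ Set.Ioc 0 h, ∀ σ ∈ Set.Icc (-θ) (h + θ), |a τ σ + b τ σ| ≤ B) :
    |w h h - w 0 0| ≤ B * h := by
  refine abs_le.2 ⟨?_, diag_sub_le hh hθ hc ha hb fun τ hτ σ hσ => (abs_le.1 (hab τ hτ σ hσ)).2⟩
  have := diag_sub_le (w := fun s r => -w s r) (a := fun s r => -a s r) (b := fun s r => -b s r)
    (B := B) hh hθ hc.neg (fun τ hτ σ hσ => (ha τ hτ σ hσ).neg)
    (fun τ hτ σ hσ => (hb τ hτ σ hσ).neg)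
    fun τ hτ σ hσ => by linarith [(abs_le.1 (hab τ hτ σ hσ)).1]
  linarith

/-- Marchaud-type inequality with a fixed base point: a bound of order `s ^ β`, `β < 1`, on second
differences based at `0` yields the same order for first differences. -/
theorem abs_sub_le_of_second_difference {φ : ℝ → ℝ} {s₀ β M C : ℝ} (hs₀ : 0 < s₀) (hβ : 0 < β)
    (hβ1 : β < 1) (hC : 0 ≤ C) (hM : ∀ s ∈ Set.Icc 0 (2 * s₀), |φ s| ≤ M)
    (h2 : ∀ s, 0 < s → s ≤ s₀ → |φ 0 - 2 * φ s + φ (2 * s)| ≤ C * s ^ β) {s : ℝ} (hs : 0 < s)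
    (hss : s ≤ 2 * s₀) : |φ s - φ 0| ≤ (2 * M / s₀ ^ β + C / (2 - 2 ^ β)) * s ^ β := by
  have hM0 : 0 ≤ M := (abs_nonneg _).trans (hM 0 ⟨le_rfl, by linarith⟩)
  have h2β : (0 : ℝ) < 2 - 2 ^ β := by
    have : (2 : ℝ) ^ β < 2 ^ (1 : ℝ) := Real.rpow_lt_rpow_of_exponent_lt (by norm_num) hβ1
    rw [Real.rpow_one] at this
    linarith
  set A := 2 * M / s₀ ^ β + C / (2 - 2 ^ β) with hA
  have hsβ : 0 < s₀ ^ β := Real.rpow_pos_of_pos hs₀ β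
  have hA1 : 2 * M ≤ A * s₀ ^ β := by
    rw [hA, add_mul, div_mul_cancel₀ _ hsβ.ne']
    have : 0 ≤ C / (2 - 2 ^ β) * s₀ ^ β := by positivity
    linarith
  have hA2 : C ≤ A * (2 - 2 ^ β) := by
    rw [hA, add_mul, div_mul_cancel₀ _ h2β.ne']
    have : 0 ≤ 2 * M / s₀ ^ β * (2 - 2 ^ β) := by positivity
    linarith
  have hA0 : 0 ≤ A := by positivity
  have key : ∀ n : ℕ, ∀ s, s₀ ≤ 2 ^ n * s → s ≤ 2 * s₀ → |φ s - φ 0| ≤ A * s ^ β := by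
    intro n
    induction n with
    | zero =>
      intro s h1 h3
      rw [pow_zero, one_mul] at h1
      have e1 := abs_le.1 (hM s ⟨by linarith, h3⟩)
      have e2 := abs_le.1 (hM 0 ⟨le_rfl, by linarith⟩)
      have e3 : A * s₀ ^ β ≤ A * s ^ β := by gcongr
      exact abs_le.2 ⟨by linarith, by linarith⟩
    | succ n ih =>
      intro s h1 h3
      have hs0 : 0 < s := by
        by_contra! hneg
        have : (2 : ℝ) ^ (n + 1) * s ≤ 0 := mul_nonpos_of_nonneg_of_nonpos (by positivity) hneg
        linarith
      by_cases hc : s ≤ s₀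
      · have e1 := abs_le.1 (ih (2 * s) (by rw [pow_succ] at h1; linarith) (by linarith))
        have e2 := abs_le.1 (h2 s hs0 hc)
        rw [Real.mul_rpow (by norm_num) hs0.le] at e1
        have e3 : C * s ^ β ≤ A * (2 - 2 ^ β) * s ^ β := by gcongr
        exact abs_le.2 ⟨by linarith [e1.1, e2.2], by linarith [e1.2, e2.1]⟩
      · push Not at hc
        have e1 := abs_le.1 (hM s ⟨by linarith, h3⟩)
        have e2 := abs_le.1 (hM 0 ⟨le_rfl, by linarith⟩)
        have e3 : A * s₀ ^ β ≤ A * s ^ β := by gcongr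
        exact abs_le.2 ⟨by linarith, by linarith⟩
  obtain ⟨n, hn⟩ := pow_unbounded_of_one_lt (s₀ / s) (one_lt_two (α := ℝ))
  exact key n s ((div_le_iff₀ hs).1 hn.le) hss

/-- Second order Taylor expansion with a Hölder continuous second derivative. -/
theorem abs_taylor_two_le {E : Type*} [NormedAddCommGroup E] [NormedSpace ℝ E] {f : E → ℝ}
    {D : Set E} {K α : ℝ} (hD : Convex ℝ D) (hK : 0 ≤ K) (hα : 0 ≤ α)
    (h1 : ∀ w ∈ D, DifferentiableAt ℝ f w)
    (h2 : ∀ w ∈ D, DifferentiableAt ℝ (fderiv ℝ f) w)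
    {v η : E} (hv : v ∈ D) (hη : v + η ∈ D)
    (h3 : ∀ w ∈ D, ‖fderiv ℝ (fderiv ℝ f) w - fderiv ℝ (fderiv ℝ f) v‖ ≤ K * ‖w - v‖ ^ α) :
    |f (v + η) - f v - fderiv ℝ f v η - (1 / 2) * fderiv ℝ (fderiv ℝ f) v η η| ≤
      K * ‖η‖ ^ α * ‖η‖ ^ 2 := by
  have hmem : ∀ s ∈ Set.Icc (0 : ℝ) 1, v + s • η ∈ D := fun s hs => by
    have := hD.add_smul_sub_mem hv hη hs
    simpa using this
  have hK' : 0 ≤ K * ‖η‖ ^ α := by positivity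
  have hder : ∀ s ∈ Set.Icc (0 : ℝ) 1,
      ‖fderiv ℝ f (v + s • η) - fderiv ℝ f v - s • fderiv ℝ (fderiv ℝ f) v η‖ ≤
        K * ‖η‖ ^ α * ‖η‖ := by
    intro s hs
    have hseg : segment ℝ v (v + s • η) ⊆ D := hD.segment_subset hv (hmem s hs)
    have := (convex_segment (𝕜 := ℝ) v (v + s • η)).norm_image_sub_le_of_norm_hasFDerivWithin_le'
      (f := fderiv ℝ f) (f' := fderiv ℝ (fderiv ℝ f)) (φ := fderiv ℝ (fderiv ℝ f) v)
      (C := K * ‖η‖ ^ α) (fun w hw => (h2 w (hseg hw)).hasFDerivAt.hasFDerivWithinAt)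
      (fun w hw => ?_) (left_mem_segment ℝ _ _) (right_mem_segment ℝ _ _)
    · have e : v + s • η - v = s • η := by abel
      rw [e, map_smul, norm_smul, Real.norm_of_nonneg hs.1] at this
      refine this.trans ?_
      gcongr
      exact mul_le_of_le_one_left (norm_nonneg _) hs.2
    · refine (h3 w (hseg hw)).trans ?_
      gcongr
      have := norm_sub_le_of_mem_segment hw
      rw [show v + s • η - v = s • η by abel, norm_smul, Real.norm_of_nonneg hs.1] at this
      exact this.trans (mul_le_of_le_one_left (norm_nonneg _) hs.2)
  set g : ℝ → ℝ := fun s =>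
    f (v + s • η) - s * fderiv ℝ f v η - s ^ 2 * ((1 / 2) * fderiv ℝ (fderiv ℝ f) v η η) with hg
  have hgd : ∀ s ∈ Set.Icc (0 : ℝ) 1, HasDerivWithinAt g
      ((fderiv ℝ f (v + s • η) - fderiv ℝ f v - s • fderiv ℝ (fderiv ℝ f) v η) η)
      (Set.Icc 0 1) s := by
    intro s hs
    have e0 : HasDerivAt (fun s : ℝ => v + s • η) η s := by
      simpa using ((hasDerivAt_id s).smul_const η).const_add v
    have e1 := (h1 _ (hmem s hs)).hasFDerivAt.comp_hasDerivAt s e0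
    have e2 : HasDerivAt (fun s : ℝ => s * fderiv ℝ f v η) (fderiv ℝ f v η) s := by
      simpa using (hasDerivAt_id s).mul_const (fderiv ℝ f v η)
    have e3 : HasDerivAt (fun s : ℝ => s ^ 2 * ((1 / 2) * fderiv ℝ (fderiv ℝ f) v η η))
        (s * fderiv ℝ (fderiv ℝ f) v η η) s := by
      refine (((hasDerivAt_id s).pow 2).mul_const
        ((1 / 2) * fderiv ℝ (fderiv ℝ f) v η η)).congr_deriv ?_
      simp only [id_eq, Nat.cast_ofNat, Nat.add_one_sub_one, pow_one, mul_one]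
      ring
    have := ((e1.sub e2).sub e3).hasDerivWithinAt (s := Set.Icc 0 1)
    refine this.congr_deriv ?_
    simp
  have := norm_image_sub_le_of_norm_deriv_le_segment_01' hgd
    (C := K * ‖η‖ ^ α * ‖η‖ * ‖η‖) fun s hs => by
      refine (ContinuousLinearMap.le_opNorm _ _).trans ?_
      gcongr
      exact hder s ⟨hs.1, hs.2.le⟩
  simp only [hg, one_smul, zero_smul, add_zero, Real.norm_eq_abs] at this
  calc _ = _ := by congr 1; ring
    _ ≤ _ := this
    _ = _ := by ring

/-- The cylinder `Q_r` centred at the origin, as a product. -/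
def prodCyl (d : ℕ) (r : ℝ) : Set (Pt d) :=
  Set.Ioo (-(r ^ 2)) 0 ×ˢ (Metric.ball (0 : Ed d) (r ^ 3) ×ˢ Metric.ball (0 : Ed d) r)

theorem mem_prodCyl {d : ℕ} {r t : ℝ} {x v : Ed d} :
    (t, x, v) ∈ prodCyl d r ↔ (-(r ^ 2) < t ∧ t < 0) ∧ ‖x‖ < r ^ 3 ∧ ‖v‖ < r := by
  simp [prodCyl]

/-- Pointwise form, with a single constant `S`, of the bounds that make up the `ℂ^{2,α}` norm
on `Q_R`. -/
structure AnisoBound {d : ℕ} (α S R : ℝ) (u : Pt d → ℝ) : Prop where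
  dt : ∀ {t x v}, (t, x, v) ∈ prodCyl d R → DifferentiableAt ℝ (fun s => u (s, x, v)) t
  dx : ∀ {t x v}, (t, x, v) ∈ prodCyl d R → DifferentiableAt ℝ (fun y => u (t, y, v)) x
  dv : ∀ {t x v}, (t, x, v) ∈ prodCyl d R → DifferentiableAt ℝ (fun w => u (t, x, w)) v
  dvv : ∀ {t x v}, (t, x, v) ∈ prodCyl d R → DifferentiableAt ℝ (fun w => Dv u (t, x, w)) v
  u_le : ∀ {t x v}, (t, x, v) ∈ prodCyl d R → ‖u (t, x, v)‖ ≤ S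
  Dv_le : ∀ {t x v}, (t, x, v) ∈ prodCyl d R → ‖Dv u (t, x, v)‖ ≤ S
  Dvv_le : ∀ {t x v}, (t, x, v) ∈ prodCyl d R → ‖Dvv u (t, x, v)‖ ≤ S
  Y_le : ∀ {t x v}, (t, x, v) ∈ prodCyl d R → ‖Yop u (t, x, v)‖ ≤ S
  u_holder : ∀ {t x v x' v'}, (t, x, v) ∈ prodCyl d R → (t, x', v') ∈ prodCyl d R →
    ‖u (t, x, v) - u (t, x', v')‖ ≤ S * (‖x - x'‖ ^ ((1 : ℝ) / 3) + ‖v - v'‖) ^ α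
  Dvv_holder : ∀ {t x v x' v'}, (t, x, v) ∈ prodCyl d R → (t, x', v') ∈ prodCyl d R →
    ‖Dvv u (t, x, v) - Dvv u (t, x', v')‖ ≤ S * (‖x - x'‖ ^ ((1 : ℝ) / 3) + ‖v - v'‖) ^ α
  Y_holder : ∀ {t x v x' v'}, (t, x, v) ∈ prodCyl d R → (t, x', v') ∈ prodCyl d R →
    ‖Yop u (t, x, v) - Yop u (t, x', v')‖ ≤ S * (‖x - x'‖ ^ ((1 : ℝ) / 3) + ‖v - v'‖) ^ α

theorem rpow_third_le {a b : ℝ} (ha : 0 ≤ a) (hb : 0 ≤ b) (h : a ≤ b ^ 3) :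
    a ^ ((1 : ℝ) / 3) ≤ b := by
  calc a ^ ((1 : ℝ) / 3) ≤ (b ^ 3) ^ ((1 : ℝ) / 3) := by gcongr
    _ = b := by
      rw [← Real.rpow_natCast, ← Real.rpow_mul hb]
      norm_num

theorem mul_rpow_le_mul_rpow {c δ α : ℝ} (hc : 1 ≤ c) (hδ : 0 ≤ δ) (hα : α ≤ 1) :
    (c * δ) ^ α ≤ c * δ ^ α := by
  rw [Real.mul_rpow (by linarith) hδ]
  gcongr
  exact Real.rpow_le_self_of_one_le hc hα

namespace AnisoBound

variable {d : ℕ} {α S R : ℝ} {u : Pt d → ℝ} {t h : ℝ} {x v x' v' : Ed d}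

theorem flow_mem (ht : -(R ^ 2) < t) (hth : t + h < 0) (hx : ‖x‖ + 2 * h * ‖v‖ < R ^ 3)
    (hv : ‖v‖ < R) {τ σ : ℝ} (hτ : τ ∈ Set.Icc 0 h) (hσ : σ ∈ Set.Icc (-h) (h + h)) :
    (t + τ, x - σ • v, v) ∈ prodCyl d R := by
  refine mem_prodCyl.2 ⟨⟨by linarith [hτ.1], by linarith [hτ.2]⟩, ?_, hv⟩
  have h1 : |σ| ≤ 2 * h := abs_le.2 ⟨by linarith [hσ.1, hτ.1.trans hτ.2], by linarith [hσ.2]⟩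
  calc ‖x - σ • v‖ ≤ ‖x‖ + |σ| * ‖v‖ := by
        refine (norm_sub_le _ _).trans_eq ?_
        rw [norm_smul, Real.norm_eq_abs]
    _ ≤ ‖x‖ + 2 * h * ‖v‖ := by gcongr
    _ < R ^ 3 := hx

theorem continuousOn_flow (H : AnisoBound α S R u) (hα : 0 < α) (ht : -(R ^ 2) < t)
    (hth : t + h < 0) (hx : ‖x‖ + 2 * h * ‖v‖ < R ^ 3) (hv : ‖v‖ < R) :
    ContinuousOn (fun p : ℝ × ℝ => u (t + p.1, x - p.2 • v, v))
      (Set.Icc 0 h ×ˢ Set.Icc (-h) (h + h)) := by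
  rintro ⟨τ₀, σ₀⟩ ⟨hτ₀, hσ₀⟩
  have hmem := flow_mem ht hth hx hv hτ₀ hσ₀
  have c1 : ContinuousAt (fun p : ℝ × ℝ => u (t + p.1, x - σ₀ • v, v)) (τ₀, σ₀) := by
    have e1 : ContinuousAt (fun s => u (s, x - σ₀ • v, v)) (t + τ₀) := (H.dt hmem).continuousAt
    have e2 : ContinuousAt (fun p : ℝ × ℝ => t + p.1) (τ₀, σ₀) := by fun_prop
    exact ContinuousAt.comp (f := fun p : ℝ × ℝ => t + p.1) e1 e2
  have c2 : Filter.Tendsto (fun p : ℝ × ℝ => u (t + p.1, x - p.2 • v, v) -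
      u (t + p.1, x - σ₀ • v, v))
      (nhdsWithin (τ₀, σ₀) (Set.Icc 0 h ×ˢ Set.Icc (-h) (h + h))) (nhds 0) := by
    refine squeeze_zero_norm' (a := fun p : ℝ × ℝ =>
      S * (‖(x - p.2 • v) - (x - σ₀ • v)‖ ^ ((1 : ℝ) / 3) + ‖v - v‖) ^ α) ?_ ?_
    · filter_upwards [self_mem_nhdsWithin] with p hp
      exact H.u_holder (flow_mem ht hth hx hv hp.1 hp.2) (flow_mem ht hth hx hv hp.1 hσ₀)
    · refine Filter.Tendsto.mono_left ?_ nhdsWithin_le_nhds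
      have : Continuous (fun p : ℝ × ℝ =>
          S * (‖(x - p.2 • v) - (x - σ₀ • v)‖ ^ ((1 : ℝ) / 3) + ‖v - v‖) ^ α) := by
        refine continuous_const.mul (Continuous.rpow_const ?_ fun _ => Or.inr hα.le)
        refine Continuous.add (Continuous.rpow_const (by fun_prop) fun _ => Or.inr (by norm_num))
          continuous_const
      have h0 := this.tendsto (τ₀, σ₀)
      simpa [Real.zero_rpow, hα.ne'] using h0
  have := c2.add c1.continuousWithinAt
  simpa [ContinuousWithinAt] using this

theorem hasDerivAt_time (H : AnisoBound α S R u) {τ : ℝ} (hm : (t + τ, x, v) ∈ prodCyl d R) :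
    HasDerivAt (fun s => u (t + s, x, v)) (Dt u (t + τ, x, v)) τ :=
  HasDerivAt.comp_const_add t τ (H.dt hm).hasDerivAt

theorem hasDerivAt_space (H : AnisoBound α S R u) {σ : ℝ}
    (hm : (t, x - σ • v, v) ∈ prodCyl d R) :
    HasDerivAt (fun s : ℝ => u (t, x - s • v, v)) (-Dx u (t, x - σ • v, v) v) σ := by
  have e0 : HasDerivAt (fun s : ℝ => x - s • v) (-v) σ := by
    simpa using ((hasDerivAt_id σ).smul_const v).const_sub x
  have := (H.dx hm).hasFDerivAt.comp_hasDerivAt σ e0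
  rw [map_neg] at this
  exact this

theorem flow_le (H : AnisoBound α S R u) (hα : 0 < α) (hh : 0 < h) (ht : -(R ^ 2) < t)
    (hth : t + h < 0) (hx : ‖x‖ + 2 * h * ‖v‖ < R ^ 3) (hv : ‖v‖ < R) :
    |u (t + h, x - h • v, v) - u (t, x, v)| ≤ S * h := by
  have := abs_diag_sub_le (w := fun τ σ => u (t + τ, x - σ • v, v))
    (a := fun τ σ => Dt u (t + τ, x - σ • v, v))
    (b := fun τ σ => -Dx u (t + τ, x - σ • v, v) v) (B := S) hh hh
    (H.continuousOn_flow hα ht hth hx hv)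
    (fun τ hτ σ hσ => H.hasDerivAt_time (flow_mem ht hth hx hv (Set.Ioc_subset_Icc_self hτ) hσ))
    (fun τ hτ σ hσ => H.hasDerivAt_space (flow_mem ht hth hx hv (Set.Ioc_subset_Icc_self hτ) hσ))
    (fun τ hτ σ hσ => H.Y_le (flow_mem ht hth hx hv (Set.Ioc_subset_Icc_self hτ) hσ))
  simpa using this

theorem flow_pair_le (H : AnisoBound α S R u) (hα : 0 < α) (hS : 0 ≤ S) (hh : 0 < h)
    (ht : -(R ^ 2) < t) (hth : t + h < 0) (hx : ‖x‖ + 2 * h * ‖v‖ < R ^ 3) (hv : ‖v‖ < R)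
    (hx' : ‖x'‖ + 2 * h * ‖v'‖ < R ^ 3) (hv' : ‖v'‖ < R) :
    |(u (t + h, x - h • v, v) - u (t + h, x' - h • v', v')) - (u (t, x, v) - u (t, x', v'))| ≤
      S * ((‖x - x'‖ + 2 * h * ‖v - v'‖) ^ ((1 : ℝ) / 3) + ‖v - v'‖) ^ α * h := by
  have := abs_diag_sub_le
    (w := fun τ σ => u (t + τ, x - σ • v, v) - u (t + τ, x' - σ • v', v'))
    (a := fun τ σ => Dt u (t + τ, x - σ • v, v) - Dt u (t + τ, x' - σ • v', v'))
    (b := fun τ σ => -Dx u (t + τ, x - σ • v, v) v - -Dx u (t + τ, x' - σ • v', v') v')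
    (B := S * ((‖x - x'‖ + 2 * h * ‖v - v'‖) ^ ((1 : ℝ) / 3) + ‖v - v'‖) ^ α) hh hh
    ((H.continuousOn_flow hα ht hth hx hv).sub (H.continuousOn_flow hα ht hth hx' hv'))
    (fun τ hτ σ hσ =>
      (H.hasDerivAt_time (flow_mem ht hth hx hv (Set.Ioc_subset_Icc_self hτ) hσ)).sub
      (H.hasDerivAt_time (flow_mem ht hth hx' hv' (Set.Ioc_subset_Icc_self hτ) hσ)))
    (fun τ hτ σ hσ =>
      (H.hasDerivAt_space (flow_mem ht hth hx hv (Set.Ioc_subset_Icc_self hτ) hσ)).sub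
      (H.hasDerivAt_space (flow_mem ht hth hx' hv' (Set.Ioc_subset_Icc_self hτ) hσ)))
    (fun τ hτ σ hσ => ?_)
  · simpa using this
  · have e := H.Y_holder (flow_mem ht hth hx hv (Set.Ioc_subset_Icc_self hτ) hσ)
      (flow_mem ht hth hx' hv' (Set.Ioc_subset_Icc_self hτ) hσ)
    have h1 : |σ| ≤ 2 * h := abs_le.2 ⟨by linarith [hσ.1], by linarith [hσ.2]⟩
    calc _ = ‖Yop u (t + τ, x - σ • v, v) - Yop u (t + τ, x' - σ • v', v')‖ := by
          rw [Real.norm_eq_abs]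
          congr 1
          simp only [Yop]
          ring
      _ ≤ _ := e
      _ ≤ _ := by
          gcongr
          calc ‖x - σ • v - (x' - σ • v')‖ = ‖(x - x') - σ • (v - v')‖ := by congr 1; module
            _ ≤ ‖x - x'‖ + |σ| * ‖v - v'‖ := by
              refine (norm_sub_le _ _).trans_eq ?_
              rw [norm_smul, Real.norm_eq_abs]
            _ ≤ ‖x - x'‖ + 2 * h * ‖v - v'‖ := by gcongr

/-- `flow_pair_le` at the kinetic scale `δ`. -/
theorem flow_pair_le_scaled (H : AnisoBound α S R u) (hα : 0 < α) (hα1 : α < 1) (hS : 0 ≤ S)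
    {δ T : ℝ} {y y' : Ed d} (hδ : 0 < δ) (hT : T = t + δ ^ 2) (ht : -(R ^ 2) < t) (hT0 : T < 0)
    (hx : ‖x‖ + 2 * δ ^ 2 * R < R ^ 3) (hv : ‖v‖ < R)
    (hx' : ‖x'‖ + 2 * δ ^ 2 * R < R ^ 3) (hv' : ‖v'‖ < R)
    (hxx : ‖x - x'‖ ≤ δ ^ 3) (hvv : ‖v - v'‖ ≤ δ)
    (hy : y = x - (δ ^ 2) • v) (hy' : y' = x' - (δ ^ 2) • v') :
    |(u (T, y, v) - u (T, y', v')) - (u (t, x, v) - u (t, x', v'))| ≤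
      3 * (S * δ ^ 2 * δ ^ α) := by
  subst hT hy hy'
  refine (H.flow_pair_le hα hS (by positivity) ht hT0 (lt_of_le_of_lt ?_ hx) hv
    (lt_of_le_of_lt ?_ hx') hv').trans ?_
  · gcongr
  · gcongr
  · have h1 : (‖x - x'‖ + 2 * δ ^ 2 * ‖v - v'‖) ^ ((1 : ℝ) / 3) ≤ 2 * δ := by
      refine rpow_third_le (by positivity) (by positivity) ?_
      calc ‖x - x'‖ + 2 * δ ^ 2 * ‖v - v'‖ ≤ δ ^ 3 + 2 * δ ^ 2 * δ := by gcongr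
        _ ≤ (2 * δ) ^ 3 := by nlinarith [pow_pos hδ 3]
    calc _ ≤ S * (2 * δ + δ) ^ α * δ ^ 2 := by gcongr
      _ = S * (3 * δ) ^ α * δ ^ 2 := by ring_nf
      _ ≤ S * (3 * δ ^ α) * δ ^ 2 := by
        gcongr
        exact mul_rpow_le_mul_rpow (by norm_num) hδ.le hα1.le
      _ = _ := by ring

theorem taylor_le (H : AnisoBound α S R u) (hα : 0 < α) (hα1 : α < 1) (hS : 0 ≤ S)
    {δ c : ℝ} {ξ w : Ed d} (hδ : 0 < δ) (hξ : ‖ξ‖ ≤ 1) (hc : |c| ≤ 3)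
    (hm : (t, x, v) ∈ prodCyl d R) (hv : ‖v‖ + 3 * δ < R) (hw : w = v + (c * δ) • ξ) :
    |u (t, x, w) - u (t, x, v) - c * (δ * Dv u (t, x, v) ξ) -
      c ^ 2 / 2 * (δ ^ 2 * Dvv u (t, x, v) ξ ξ)| ≤ 27 * (S * δ ^ 2 * δ ^ α) := by
  subst hw
  have hm' := mem_prodCyl.1 hm
  have hη : ‖(c * δ) • ξ‖ ≤ 3 * δ := by
    rw [norm_smul, Real.norm_eq_abs, abs_mul, abs_of_pos hδ]
    calc |c| * δ * ‖ξ‖ ≤ 3 * δ * 1 := by gcongr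
      _ = 3 * δ := mul_one _
  have hball : ∀ w ∈ Metric.ball (0 : Ed d) R, (t, x, w) ∈ prodCyl d R := fun w hw =>
    mem_prodCyl.2 ⟨hm'.1, hm'.2.1, mem_ball_zero_iff.1 hw⟩
  have := abs_taylor_two_le (f := fun w => u (t, x, w)) (η := (c * δ) • ξ) (K := S) (α := α)
    (convex_ball (0 : Ed d) R) hS hα.le (fun w hw => H.dv (hball w hw))
    (fun w hw => H.dvv (hball w hw)) (mem_ball_zero_iff.2 hm'.2.2)
    (mem_ball_zero_iff.2 (by linarith [norm_add_le v ((c * δ) • ξ)]))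
    (fun w hw => by
      have := H.Dvv_holder (hball w hw) hm
      rw [sub_self, norm_zero, Real.zero_rpow (by norm_num), zero_add] at this
      exact this)
  calc _ = |u (t, x, v + (c * δ) • ξ) - u (t, x, v) - Dv u (t, x, v) ((c * δ) • ξ) -
        1 / 2 * Dvv u (t, x, v) ((c * δ) • ξ) ((c * δ) • ξ)| := by
        congr 1
        simp only [map_smul, smul_eq_mul, _root_.smul_apply]
        ring
    _ ≤ S * ‖(c * δ) • ξ‖ ^ α * ‖(c * δ) • ξ‖ ^ 2 := this
    _ ≤ S * (3 * δ) ^ α * (3 * δ) ^ 2 := by gcongr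
    _ ≤ S * (3 * δ ^ α) * (3 * δ) ^ 2 := by
        gcongr
        exact mul_rpow_le_mul_rpow (by norm_num) hδ.le hα1.le
    _ = _ := by ring

theorem Dvv_space_le (H : AnisoBound α S R u) (hα : 0 < α) (hα1 : α < 1) (hS : 0 ≤ S)
    {δ : ℝ} {ξ : Ed d} (hδ : 0 < δ) (hξ : ‖ξ‖ ≤ 1)
    (hm : (t, x, v) ∈ prodCyl d R) (hm' : (t, x', v) ∈ prodCyl d R) (hxx : ‖x - x'‖ ≤ 2 * δ ^ 3) :
    |δ ^ 2 * Dvv u (t, x, v) ξ ξ - δ ^ 2 * Dvv u (t, x', v) ξ ξ| ≤ 2 * (S * δ ^ 2 * δ ^ α) := by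
  have h1 : ‖x - x'‖ ^ ((1 : ℝ) / 3) ≤ 2 * δ := by
    refine rpow_third_le (by positivity) (by positivity) (hxx.trans ?_)
    nlinarith [pow_pos hδ 3]
  have h2 : ‖Dvv u (t, x, v) - Dvv u (t, x', v)‖ ≤ S * (2 * δ ^ α) := by
    refine (H.Dvv_holder hm hm').trans ?_
    rw [sub_self, norm_zero, add_zero]
    gcongr
    calc _ ≤ (2 * δ) ^ α := by gcongr
      _ ≤ _ := mul_rpow_le_mul_rpow (by norm_num) hδ.le hα1.le
  have h3 := (Dvv u (t, x, v) - Dvv u (t, x', v)).le_opNorm₂ ξ ξ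
  calc _ = δ ^ 2 * ‖(Dvv u (t, x, v) - Dvv u (t, x', v)) ξ ξ‖ := by
        rw [← mul_sub, abs_mul, abs_of_pos (by positivity)]
        simp
    _ ≤ δ ^ 2 * (S * (2 * δ ^ α) * 1 * 1) := by
        gcongr
        exact h3.trans (by gcongr)
    _ = _ := by ring

theorem second_diff_Dv_le (H : AnisoBound α S R u) (hα : 0 < α) (hα1 : α < 1) (hS : 0 ≤ S)
    {δ T : ℝ} {ξ : Ed d} (hδ : 0 < δ) (hδ1 : δ ≤ 1) (hξ : ‖ξ‖ ≤ 1) (hT : T = t + δ ^ 2)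
    (ht : -(R ^ 2) < t) (hT0 : T < 0) (hx : ‖x‖ + (3 * R + 2) * δ < R ^ 3)
    (hv : ‖v‖ + 3 * δ < R) :
    |Dv u (T, x, v) ξ - 2 * Dv u (T, x - δ ^ 3 • ξ, v) ξ + Dv u (T, x - (2 * δ ^ 3) • ξ, v) ξ| ≤
      1000 * S * (δ * δ ^ α) := by
  have hR : 0 < R := by linarith [norm_nonneg v]
  have hδ2 : δ ^ 2 ≤ δ := by nlinarith
  have hδ3 : δ ^ 3 ≤ δ := by nlinarith [pow_pos hδ 2]
  have p2 : 0 < δ ^ 2 := by positivity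
  have p3 : 0 < δ ^ 3 := by positivity
  have hRδ : δ ^ 2 * R ≤ δ * R := by gcongr
  have hδR : 0 < δ * R := by positivity
  have hξv : ‖v‖ ≤ R := by linarith
  obtain ⟨V1, hV1⟩ : ∃ V, V = v + (1 * δ) • ξ := ⟨_, rfl⟩
  obtain ⟨V2, hV2⟩ : ∃ V, V = v + (2 * δ) • ξ := ⟨_, rfl⟩
  obtain ⟨V3, hV3⟩ : ∃ V, V = v + (3 * δ) • ξ := ⟨_, rfl⟩
  obtain ⟨X0, hX0⟩ : ∃ X, X = x + δ ^ 2 • v := ⟨_, rfl⟩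
  obtain ⟨X1, hX1⟩ : ∃ X, X = X0 + δ ^ 3 • ξ := ⟨_, rfl⟩
  obtain ⟨Y1, hY1⟩ : ∃ Y, Y = x - δ ^ 3 • ξ := ⟨_, rfl⟩
  obtain ⟨Y2, hY2⟩ : ∃ Y, Y = x - (2 * δ ^ 3) • ξ := ⟨_, rfl⟩
  rw [← hY1, ← hY2]
  have nξ : ∀ c : ℝ, 0 ≤ c → ‖c • ξ‖ ≤ c := fun c hc => by
    rw [norm_smul, Real.norm_of_nonneg hc]
    exact mul_le_of_le_one_right hc hξ
  have nV1 : ‖V1‖ < R := by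
    rw [hV1]; linarith [norm_add_le v ((1 * δ) • ξ), nξ (1 * δ) (by positivity)]
  have nV2 : ‖V2‖ < R := by
    rw [hV2]; linarith [norm_add_le v ((2 * δ) • ξ), nξ (2 * δ) (by positivity)]
  have nV3 : ‖V3‖ < R := by
    rw [hV3]; linarith [norm_add_le v ((3 * δ) • ξ), nξ (3 * δ) (by positivity)]
  have nv : ‖v‖ < R := by linarith
  have nX0 : ‖X0‖ ≤ ‖x‖ + δ * R := by
    have : ‖δ ^ 2 • v‖ ≤ δ * R := by
      rw [norm_smul, Real.norm_of_nonneg p2.le]; gcongr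
    rw [hX0]; linarith [norm_add_le x (δ ^ 2 • v)]
  have nX1 : ‖X1‖ ≤ ‖x‖ + δ * R + δ := by
    rw [hX1]; linarith [norm_add_le X0 (δ ^ 3 • ξ), nξ (δ ^ 3) p3.le]
  have nY1 : ‖Y1‖ ≤ ‖x‖ + 2 * δ := by
    rw [hY1]; linarith [norm_sub_le x (δ ^ 3 • ξ), nξ (δ ^ 3) p3.le]
  have nY2 : ‖Y2‖ ≤ ‖x‖ + 2 * δ := by
    rw [hY2]; linarith [norm_sub_le x ((2 * δ ^ 3) • ξ), nξ (2 * δ ^ 3) (by positivity)]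
  have mX0 : (t, X0, v) ∈ prodCyl d R :=
    mem_prodCyl.2 ⟨⟨ht, by linarith⟩, by linarith, nv⟩
  have mX1 : (t, X1, v) ∈ prodCyl d R :=
    mem_prodCyl.2 ⟨⟨ht, by linarith⟩, by linarith, nv⟩
  have mx : (T, x, v) ∈ prodCyl d R :=
    mem_prodCyl.2 ⟨⟨by linarith, hT0⟩, by linarith, nv⟩
  have mY1 : (T, Y1, v) ∈ prodCyl d R :=
    mem_prodCyl.2 ⟨⟨by linarith, hT0⟩, by linarith, nv⟩
  have mY2 : (T, Y2, v) ∈ prodCyl d R :=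
    mem_prodCyl.2 ⟨⟨by linarith, hT0⟩, by linarith, nv⟩
  have tay {s : ℝ} {y w : Ed d} (c : ℝ) (hc : |c| ≤ 3) (hm : (s, y, v) ∈ prodCyl d R)
    (hw : w = v + (c * δ) • ξ) := abs_le.1 (H.taylor_le hα hα1 hS hδ hξ hc hm hv hw)
  have a1 := tay 1 (by norm_num) mX0 hV1
  have a2 := tay 2 (by norm_num) mX0 hV2
  have a3 := tay 1 (by norm_num) mX1 hV1
  have a4 := tay 2 (by norm_num) mX1 hV2
  have a5 := tay 3 (by norm_num) mX1 hV3
  have a6 := tay 1 (by norm_num) mx hV1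
  have a7 := tay 1 (by norm_num) mY1 hV1
  have a8 := tay 2 (by norm_num) mY1 hV2
  have a9 := tay 2 (by norm_num) mY2 hV2
  have a10 := tay 3 (by norm_num) mY2 hV3
  have c1 := abs_le.1 (H.Dvv_space_le hα hα1 hS hδ hξ mX0 mX1 (by
    rw [hX1, sub_add_cancel_left, norm_neg]
    linarith [nξ (δ ^ 3) p3.le]))
  have c2 := abs_le.1 (H.Dvv_space_le hα hα1 hS hδ hξ mx mY1 (by
    rw [hY1, _root_.sub_sub_cancel]
    linarith [nξ (δ ^ 3) p3.le]))
  have c3 := abs_le.1 (H.Dvv_space_le hα hα1 hS hδ hξ mx mY2 (by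
    rw [hY2, _root_.sub_sub_cancel]
    linarith [nξ (2 * δ ^ 3) (by positivity)]))
  have hXX : ‖X0 - X1‖ ≤ δ ^ 3 := by
    rw [hX1, sub_add_cancel_left, norm_neg]
    exact nξ _ p3.le
  have hvv : ∀ w w' : Ed d, w - w' = -(δ • ξ) → ‖w - w'‖ ≤ δ := fun w w' e => by
    rw [e, norm_neg]
    exact nξ _ hδ.le
  have f1 := abs_le.1 (H.flow_pair_le_scaled (v := v) (v' := V1) (y := x) (y' := x) hα hα1 hS hδ hT
    ht hT0 (by linarith) nv (by linarith) nV1 hXX (hvv _ _ (by rw [hV1]; module))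
    (by rw [hX0]; module) (by rw [hX1, hX0, hV1]; module))
  have f2 := abs_le.1 (H.flow_pair_le_scaled (v := V1) (v' := V2) (y := Y1) (y' := Y1) hα hα1 hS
    hδ hT ht hT0 (by linarith) nV1 (by linarith) nV2 hXX (hvv _ _ (by rw [hV1, hV2]; module))
    (by rw [hY1, hX0, hV1]; module) (by rw [hY1, hX1, hX0, hV2]; module))
  have f3 := abs_le.1 (H.flow_pair_le_scaled (v := V2) (v' := V3) (y := Y2) (y' := Y2) hα hα1 hS
    hδ hT ht hT0 (by linarith) nV2 (by linarith) nV3 hXX (hvv _ _ (by rw [hV2, hV3]; module))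
    (by rw [hY2, hX0, hV2]; module) (by rw [hY2, hX1, hX0, hV3]; module))
  have hE : 0 ≤ S * δ ^ 2 * δ ^ α := by positivity
  have key : |δ * (Dv u (T, x, v) ξ - 2 * Dv u (T, Y1, v) ξ + Dv u (T, Y2, v) ξ)| ≤
      1000 * (S * δ ^ 2 * δ ^ α) := by
    rw [mul_add, mul_sub]
    exact abs_le.2 ⟨by linarith, by linarith⟩
  rw [abs_mul, abs_of_pos hδ] at key
  refine le_of_mul_le_mul_left (key.trans_eq ?_) hδ
  ring

/-- The constant in the Hölder estimate of `D_v u` in the spatial variable. -/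
noncomputable def spaceConst (α δ₀ : ℝ) : ℝ :=
  2 / (δ₀ ^ 3) ^ ((1 + α) / 3) + 1000 / (2 - 2 ^ ((1 + α) / 3))

theorem spaceConst_nonneg {δ₀ : ℝ} (hα1 : α < 1) (hδ₀ : 0 < δ₀) : 0 ≤ spaceConst α δ₀ := by
  have : (2 : ℝ) ^ ((1 + α) / 3) ≤ 2 ^ (1 : ℝ) :=
    Real.rpow_le_rpow_of_exponent_le (by norm_num) (by linarith)
  rw [Real.rpow_one] at this
  have : 0 ≤ 2 - (2 : ℝ) ^ ((1 + α) / 3) := by linarith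
  unfold spaceConst
  positivity

theorem Dv_space_le (H : AnisoBound α S R u) (hα : 0 < α) (hα1 : α < 1) (hS : 0 ≤ S)
    {δ δ₀ T : ℝ} {ξ : Ed d} (hδ : 0 < δ) (hδδ : δ ≤ δ₀) (hδ1 : δ₀ ≤ 1) (hξ : ‖ξ‖ ≤ 1)
    (hT : -(R ^ 2) < T - δ₀ ^ 2) (hT0 : T < 0) (hx : ‖x‖ + (3 * R + 2) * δ₀ < R ^ 3)
    (hv : ‖v‖ + 3 * δ₀ < R) :
    |δ * Dv u (T, x - δ ^ 3 • ξ, v) ξ - δ * Dv u (T, x, v) ξ| ≤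
      spaceConst α δ₀ * (S * δ ^ 2 * δ ^ α) := by
  have hδ₀ : 0 < δ₀ := hδ.trans_le hδδ
  have hR : 0 < R := by linarith [norm_nonneg v]
  have hδ3 : δ₀ ^ 3 ≤ δ₀ := by
    calc δ₀ ^ 3 = δ₀ * δ₀ ^ 2 := by ring
      _ ≤ δ₀ * 1 := by gcongr; exact pow_le_one₀ hδ₀.le hδ1
      _ = δ₀ := mul_one _
  have cube : ∀ r : ℝ, 0 < r → (r ^ 3) ^ ((1 + α) / 3) = r * r ^ α := fun r hr => by
    rw [← Real.rpow_natCast, ← Real.rpow_mul hr.le]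
    rw [show ((3 : ℕ) : ℝ) * ((1 + α) / 3) = 1 + α by push_cast; ring, Real.rpow_add hr,
      Real.rpow_one]
  have := abs_sub_le_of_second_difference (φ := fun s => Dv u (T, x - s • ξ, v) ξ)
    (s₀ := δ₀ ^ 3) (β := (1 + α) / 3) (M := S) (C := 1000 * S) (by positivity) (by positivity)
    (by linarith) (by positivity) (fun s hs => ?_) (fun s hs hss => ?_) (s := δ ^ 3)
    (by positivity) (by
      have : δ ^ 3 ≤ δ₀ ^ 3 := by gcongr
      linarith [pow_pos hδ₀ 3])
  · simp only [zero_smul, sub_zero] at this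
    rw [← mul_sub, abs_mul, abs_of_pos hδ]
    refine (mul_le_mul_of_nonneg_left this hδ.le).trans_eq ?_
    rw [cube δ hδ, spaceConst]
    ring
  · have hm : (T, x - s • ξ, v) ∈ prodCyl d R := by
      refine mem_prodCyl.2 ⟨⟨by linarith [pow_pos hδ₀ 2], hT0⟩, ?_, by linarith⟩
      have h1 : ‖s • ξ‖ ≤ s := by
        rw [norm_smul, Real.norm_of_nonneg hs.1]
        exact mul_le_of_le_one_right hs.1 hξ
      have h2 : 0 < R * δ₀ := by positivity
      linarith [norm_sub_le x (s • ξ), hs.2]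
    calc |Dv u (T, x - s • ξ, v) ξ| ≤ ‖Dv u (T, x - s • ξ, v)‖ * ‖ξ‖ :=
          (Dv u (T, x - s • ξ, v)).le_opNorm ξ
      _ ≤ S * 1 := by gcongr; exact H.Dv_le hm
      _ = S := mul_one _
  · obtain ⟨r, hr, rfl⟩ : ∃ r > 0, s = r ^ 3 := by
      refine ⟨s ^ ((1 : ℝ) / 3), by positivity, ?_⟩
      rw [← Real.rpow_natCast, ← Real.rpow_mul hs.le]
      norm_num
    have hrr : r ≤ δ₀ := le_of_pow_le_pow_left₀ (by norm_num) hδ₀.le hss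
    have hr2 : r ^ 2 ≤ δ₀ ^ 2 := by gcongr
    have hxr : (3 * R + 2) * r ≤ (3 * R + 2) * δ₀ := by gcongr
    rw [cube r hr]
    simpa using H.second_diff_Dv_le (t := T - r ^ 2) (T := T) (x := x) (v := v) hα hα1 hS hr
      (hrr.trans hδ1) hξ (by ring) (by linarith) hT0 (by linarith) (by linarith)

theorem second_diff_space_le (H : AnisoBound α S R u) (hα : 0 < α) (hα1 : α < 1) (hS : 0 ≤ S)
    {δ δ₀ T : ℝ} {ξ : Ed d} (hδ : 0 < δ) (hδδ : δ ≤ δ₀) (hδ1 : δ₀ ≤ 1) (hξ : ‖ξ‖ ≤ 1)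
    (hT : T = t + δ ^ 2) (ht : -(R ^ 2) < t - δ₀ ^ 2) (hT0 : T < 0)
    (hx : ‖x‖ + (4 * R + 3) * δ₀ < R ^ 3) (hv : ‖v‖ + 3 * δ₀ < R) :
    |u (T, x - δ ^ 3 • ξ, v) - 2 * u (T, x, v) + u (T, x + δ ^ 3 • ξ, v)| ≤
      (2 * spaceConst α δ₀ + 120) * (S * δ ^ 2 * δ ^ α) := by
  have hδ₀ : 0 < δ₀ := hδ.trans_le hδδ
  have hR : 0 < R := by linarith [norm_nonneg v]
  have hδ2 : δ ^ 2 ≤ δ₀ := by nlinarith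
  have hδ3 : δ ^ 3 ≤ δ₀ := by nlinarith [pow_pos hδ 2]
  have p2 : 0 < δ ^ 2 := by positivity
  have p3 : 0 < δ ^ 3 := by positivity
  have q2 : 0 < δ₀ ^ 2 := by positivity
  have hRδ : δ ^ 2 * R ≤ δ₀ * R := by gcongr
  have hδR : 0 < δ₀ * R := by positivity
  have hξv : ‖v‖ ≤ R := by linarith
  obtain ⟨V1, hV1⟩ : ∃ V, V = v + (1 * δ) • ξ := ⟨_, rfl⟩
  obtain ⟨X0, hX0⟩ : ∃ X, X = x + δ ^ 2 • v := ⟨_, rfl⟩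
  obtain ⟨X1, hX1⟩ : ∃ X, X = X0 + δ ^ 3 • ξ := ⟨_, rfl⟩
  have nξ : ∀ c : ℝ, 0 ≤ c → ‖c • ξ‖ ≤ c := fun c hc => by
    rw [norm_smul, Real.norm_of_nonneg hc]
    exact mul_le_of_le_one_right hc hξ
  have nV1 : ‖V1‖ < R := by
    rw [hV1]; linarith [norm_add_le v ((1 * δ) • ξ), nξ (1 * δ) (by positivity)]
  have nv : ‖v‖ < R := by linarith
  have nX0 : ‖X0‖ ≤ ‖x‖ + δ₀ * R := by
    have : ‖δ ^ 2 • v‖ ≤ δ₀ * R := by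
      rw [norm_smul, Real.norm_of_nonneg p2.le]; gcongr
    rw [hX0]; linarith [norm_add_le x (δ ^ 2 • v)]
  have nX1 : ‖X1‖ ≤ ‖x‖ + δ₀ * R + δ₀ := by
    rw [hX1]; linarith [norm_add_le X0 (δ ^ 3 • ξ), nξ (δ ^ 3) p3.le]
  have d1 := abs_le.1 (H.Dv_space_le hα hα1 hS hδ hδδ hδ1 hξ (T := T) (x := x) (v := v)
    (by linarith) hT0 (by linarith) hv)
  have d2 := abs_le.1 (H.Dv_space_le hα hα1 hS hδ hδδ hδ1 hξ (T := t) (x := X1) (v := v)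
    ht (by linarith) (by linarith) hv)
  rw [show X1 - δ ^ 3 • ξ = X0 by rw [hX1]; module] at d2
  obtain ⟨Y1, hY1⟩ : ∃ Y, Y = x - δ ^ 3 • ξ := ⟨_, rfl⟩
  obtain ⟨Y2, hY2⟩ : ∃ Y, Y = x + δ ^ 3 • ξ := ⟨_, rfl⟩
  rw [← hY1] at d1
  rw [← hY1, ← hY2]
  have nY1 : ‖Y1‖ ≤ ‖x‖ + δ₀ := by
    rw [hY1]; linarith [norm_sub_le x (δ ^ 3 • ξ), nξ (δ ^ 3) p3.le]
  have mX0 : (t, X0, v) ∈ prodCyl d R :=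
    mem_prodCyl.2 ⟨⟨by linarith, by linarith⟩, by linarith, nv⟩
  have mX1 : (t, X1, v) ∈ prodCyl d R :=
    mem_prodCyl.2 ⟨⟨by linarith, by linarith⟩, by linarith, nv⟩
  have mx : (T, x, v) ∈ prodCyl d R :=
    mem_prodCyl.2 ⟨⟨by linarith, hT0⟩, by linarith, nv⟩
  have mY1 : (T, Y1, v) ∈ prodCyl d R :=
    mem_prodCyl.2 ⟨⟨by linarith, hT0⟩, by linarith, nv⟩
  have tay {s : ℝ} {y : Ed d} (hm : (s, y, v) ∈ prodCyl d R) :=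
    abs_le.1 (H.taylor_le (c := 1) hα hα1 hS hδ hξ (by norm_num) hm (by linarith) hV1)
  have a1 := tay mX0
  have a2 := tay mX1
  have a3 := tay mx
  have a4 := tay mY1
  have hXX : ‖X1 - X0‖ ≤ δ ^ 3 := by
    rw [hX1, add_sub_cancel_left]
    exact nξ _ p3.le
  have c1 := abs_le.1 (H.Dvv_space_le hα hα1 hS hδ hξ mX1 mX0 (by linarith))
  have c2 := abs_le.1 (H.Dvv_space_le hα hα1 hS hδ hξ mx mY1 (by
    rw [hY1, _root_.sub_sub_cancel]
    linarith [nξ (δ ^ 3) p3.le]))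
  have hvv : ∀ w : Ed d, ‖w - w‖ ≤ δ := fun w => by
    rw [sub_self, norm_zero]
    exact hδ.le
  have f1 := abs_le.1 (H.flow_pair_le_scaled (v := V1) (v' := V1) (y := x) (y' := Y1) hα hα1 hS hδ
    hT (by linarith) hT0 (by linarith) nV1 (by linarith) nV1 hXX (hvv _)
    (by rw [hX1, hX0, hV1]; module) (by rw [hY1, hX0, hV1]; module))
  have f2 := abs_le.1 (H.flow_pair_le_scaled (v := v) (v' := v) (y := Y2) (y' := x) hα hα1 hS hδ
    hT (by linarith) hT0 (by linarith) nv (by linarith) nv hXX (hvv _)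
    (by rw [hY2, hX1, hX0]; module) (by rw [hX0]; module))
  have hE : 0 ≤ S * δ ^ 2 * δ ^ α := by positivity
  exact abs_le.2 ⟨by linarith, by linarith⟩

theorem Dvv_flow_apply_le (H : AnisoBound α S R u) (hα : 0 < α) (hα1 : α < 1) (hS : 0 ≤ S)
    {δ δ₀ T : ℝ} {ξ : Ed d} (hδ : 0 < δ) (hδδ : δ ≤ δ₀) (hδ1 : δ₀ ≤ 1) (hξ : ‖ξ‖ ≤ 1)
    (hT : T = t + δ ^ 2) (ht : -(R ^ 2) < t - δ₀ ^ 2) (hT0 : T < 0)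
    (hx : ‖x‖ + (5 * R + 3) * δ₀ < R ^ 3) (hv : ‖v‖ + 3 * δ₀ < R) :
    |Dvv u (T, x - δ ^ 2 • v, v) ξ ξ - Dvv u (t, x, v) ξ ξ| ≤
      (4 * spaceConst α δ₀ + 300) * (S * δ ^ α) := by
  have hδ₀ : 0 < δ₀ := hδ.trans_le hδδ
  have hR : 0 < R := by linarith [norm_nonneg v]
  have hδ2 : δ ^ 2 ≤ δ₀ := by nlinarith
  have hδ3 : δ ^ 3 ≤ δ₀ := by nlinarith [pow_pos hδ 2]
  have p2 : 0 < δ ^ 2 := by positivity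
  have p3 : 0 < δ ^ 3 := by positivity
  have q2 : 0 < δ₀ ^ 2 := by positivity
  have hRδ : δ ^ 2 * R ≤ δ₀ * R := by gcongr
  have hδR : 0 < δ₀ * R := by positivity
  have hξv : ‖v‖ ≤ R := by linarith
  have nv : ‖v‖ < R := by linarith
  obtain ⟨V1, hV1⟩ : ∃ V, V = v + (1 * δ) • ξ := ⟨_, rfl⟩
  obtain ⟨V2, hV2⟩ : ∃ V, V = v + (-1 * δ) • ξ := ⟨_, rfl⟩
  obtain ⟨y, hy⟩ : ∃ y, y = x - δ ^ 2 • v := ⟨_, rfl⟩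
  rw [← hy]
  have nξ : ∀ c : ℝ, 0 ≤ c → ‖c • ξ‖ ≤ c := fun c hc => by
    rw [norm_smul, Real.norm_of_nonneg hc]
    exact mul_le_of_le_one_right hc hξ
  have nV1 : ‖V1‖ < R := by
    rw [hV1]; linarith [norm_add_le v ((1 * δ) • ξ), nξ (1 * δ) (by positivity)]
  have nV2 : ‖V2‖ < R := by
    rw [hV2, neg_one_mul, neg_smul, ← sub_eq_add_neg]
    linarith [norm_sub_le v (δ • ξ), nξ δ hδ.le]
  have ny : ‖y‖ ≤ ‖x‖ + δ₀ * R := by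
    have : ‖δ ^ 2 • v‖ ≤ δ₀ * R := by
      rw [norm_smul, Real.norm_of_nonneg p2.le]; gcongr
    rw [hy]; linarith [norm_sub_le x (δ ^ 2 • v)]
  have d0 := abs_le.1 (H.second_diff_space_le hα hα1 hS hδ hδδ hδ1 hξ (x := y) (v := v)
    hT ht hT0 (by linarith) hv)
  have d1 := abs_le.1 (H.Dv_space_le hα hα1 hS hδ hδδ hδ1 hξ (T := T) (x := y) (v := v)
    (by linarith) hT0 (by linarith) hv)
  have d2 := abs_le.1 (H.Dv_space_le hα hα1 hS hδ hδδ hδ1 (ξ := -ξ) (by rwa [norm_neg]) (T := T)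
    (x := y) (v := v) (by linarith) hT0 (by linarith) hv)
  rw [smul_neg, sub_neg_eq_add, map_neg, map_neg] at d2
  obtain ⟨Y1, hY1⟩ : ∃ Y, Y = y - δ ^ 3 • ξ := ⟨_, rfl⟩
  obtain ⟨Y2, hY2⟩ : ∃ Y, Y = y + δ ^ 3 • ξ := ⟨_, rfl⟩
  rw [← hY1] at d1
  rw [← hY2] at d2
  rw [← hY1, ← hY2] at d0
  have nY1 : ‖Y1‖ ≤ ‖y‖ + δ₀ := by
    rw [hY1]; linarith [norm_sub_le y (δ ^ 3 • ξ), nξ (δ ^ 3) p3.le]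
  have nY2 : ‖Y2‖ ≤ ‖y‖ + δ₀ := by
    rw [hY2]; linarith [norm_add_le y (δ ^ 3 • ξ), nξ (δ ^ 3) p3.le]
  have mx : (t, x, v) ∈ prodCyl d R :=
    mem_prodCyl.2 ⟨⟨by linarith, by linarith⟩, by linarith, nv⟩
  have my : (T, y, v) ∈ prodCyl d R :=
    mem_prodCyl.2 ⟨⟨by linarith, hT0⟩, by linarith, nv⟩
  have mY1 : (T, Y1, v) ∈ prodCyl d R :=
    mem_prodCyl.2 ⟨⟨by linarith, hT0⟩, by linarith, nv⟩
  have mY2 : (T, Y2, v) ∈ prodCyl d R :=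
    mem_prodCyl.2 ⟨⟨by linarith, hT0⟩, by linarith, nv⟩
  have tay {s : ℝ} {y w : Ed d} (c : ℝ) (hc : |c| ≤ 3) (hm : (s, y, v) ∈ prodCyl d R)
    (hw : w = v + (c * δ) • ξ) := abs_le.1 (H.taylor_le hα hα1 hS hδ hξ hc hm (by linarith) hw)
  have a1 := tay 1 (by norm_num) mx hV1
  have a2 := tay (-1) (by norm_num) mx hV2
  have a3 := tay 1 (by norm_num) mY1 hV1
  have a4 := tay (-1) (by norm_num) mY2 hV2
  have c1 := abs_le.1 (H.Dvv_space_le hα hα1 hS hδ hξ my mY1 (by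
    rw [hY1, _root_.sub_sub_cancel]
    linarith [nξ (δ ^ 3) p3.le]))
  have c2 := abs_le.1 (H.Dvv_space_le hα hα1 hS hδ hξ my mY2 (by
    rw [hY2, sub_add_cancel_left, norm_neg]
    linarith [nξ (δ ^ 3) p3.le]))
  have hXX : ‖x - x‖ ≤ δ ^ 3 := by
    rw [sub_self, norm_zero]
    exact p3.le
  have f1 := abs_le.1 (H.flow_pair_le_scaled (v := V1) (v' := v) (y := Y1) (y' := y) hα hα1 hS hδ
    hT (by linarith) hT0 (by linarith) nV1 (by linarith) nv hXX
    (by rw [hV1, add_sub_cancel_left, one_mul]; exact nξ _ hδ.le)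
    (by rw [hY1, hy, hV1]; module) hy)
  have f2 := abs_le.1 (H.flow_pair_le_scaled (v := V2) (v' := v) (y := Y2) (y' := y) hα hα1 hS hδ
    hT (by linarith) hT0 (by linarith) nV2 (by linarith) nv hXX
    (by rw [hV2, add_sub_cancel_left, neg_one_mul, neg_smul, norm_neg]; exact nξ _ hδ.le)
    (by rw [hY2, hy, hV2]; module) hy)
  have hE : 0 ≤ S * δ ^ 2 * δ ^ α := by positivity
  have key : |δ ^ 2 * (Dvv u (T, y, v) ξ ξ - Dvv u (t, x, v) ξ ξ)| ≤
      (4 * spaceConst α δ₀ + 300) * (S * δ ^ 2 * δ ^ α) := by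
    rw [mul_sub]
    exact abs_le.2 ⟨by linarith, by linarith⟩
  rw [abs_mul, abs_of_pos p2] at key
  refine le_of_mul_le_mul_left (key.trans_eq ?_) p2
  ring

end AnisoBound

theorem opNorm_le_of_symm_of_quadratic_le {E : Type*} [NormedAddCommGroup E] [NormedSpace ℝ E]
    {L : E →L[ℝ] E →L[ℝ] ℝ} {C : ℝ} (hC : 0 ≤ C) (hL : ∀ a b, L a b = L b a)
    (h : ∀ ξ, ‖ξ‖ ≤ 1 → |L ξ ξ| ≤ C) : ‖L‖ ≤ 2 * C := by
  refine ContinuousLinearMap.opNorm_le_of_unit_norm (by positivity) fun a ha =>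
    ContinuousLinearMap.opNorm_le_of_unit_norm (by positivity) fun b hb => ?_
  have h1 := abs_le.1 (h ((1 / 2 : ℝ) • (a + b)) (by
    rw [norm_smul, Real.norm_of_nonneg (by norm_num)]
    linarith [norm_add_le a b]))
  have h2 := abs_le.1 (h ((1 / 2 : ℝ) • (a - b)) (by
    rw [norm_smul, Real.norm_of_nonneg (by norm_num)]
    linarith [norm_sub_le a b]))
  simp only [map_smul, map_add, map_sub, _root_.smul_apply, _root_.add_apply, _root_.sub_apply,
    smul_eq_mul, hL b a] at h1 h2
  exact abs_le.2 ⟨by linarith, by linarith⟩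

/-- Hölder continuity for the kinetic quasi-distance from Hölder continuity in `(x, v)` and an
estimate along the flow of the transport operator. -/
theorem norm_sub_le_kRho_rpow {d : ℕ} {F : Type*} [NormedAddCommGroup F] {g : Pt d → F}
    {α r R δ₀ M K A : ℝ} (hα : 0 < α) (hα1 : α < 1) (hδ₀ : 0 < δ₀) (hrR : r ≤ R)
    (hrR2 : r ^ 2 ≤ R ^ 2) (hr3 : r ^ 3 + δ₀ ^ 2 * r < R ^ 3) (hM0 : 0 ≤ M) (hK0 : 0 ≤ K)
    (hA0 : 0 ≤ A)
    (hM : ∀ {t : ℝ} {x v : Ed d}, (t, x, v) ∈ prodCyl d r → ‖g (t, x, v)‖ ≤ M)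
    (hK : ∀ {t : ℝ} {x v x' v' : Ed d}, (t, x, v) ∈ prodCyl d R → (t, x', v') ∈ prodCyl d R →
      ‖g (t, x, v) - g (t, x', v')‖ ≤ K * (‖x - x'‖ ^ ((1 : ℝ) / 3) + ‖v - v'‖) ^ α)
    (hA : ∀ {t h : ℝ} {x v : Ed d}, 0 < h → h ≤ δ₀ ^ 2 → -(r ^ 2) < t → t + h < 0 →
      ‖x‖ < r ^ 3 + δ₀ ^ 2 * r → ‖v‖ < r →
      ‖g (t + h, x - h • v, v) - g (t, x, v)‖ ≤ A * (h ^ ((1 : ℝ) / 2)) ^ α)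
    {z z' : Pt d} (hz : z ∈ prodCyl d r) (hz' : z' ∈ prodCyl d r) :
    ‖g z - g z'‖ ≤ (A + 2 * K + 2 * M / δ₀ ^ α) * kRho z z' ^ α := by
  obtain ⟨t, x, v⟩ := z
  obtain ⟨t', x', v'⟩ := z'
  obtain ⟨⟨ht, ht0⟩, hx, hv⟩ := mem_prodCyl.1 hz
  obtain ⟨⟨ht', ht0'⟩, hx', hv'⟩ := mem_prodCyl.1 hz'
  have hr : 0 < r := (norm_nonneg v).trans_lt hv
  obtain ⟨ρ, hρ⟩ : ∃ ρ, ρ = kRho (t, x, v) (t', x', v') := ⟨_, rfl⟩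
  have ρ1 : |t - t'| ^ ((1 : ℝ) / 2) ≤ ρ := by rw [hρ]; exact le_max_left _ _
  have ρ2 : ‖x - x' + (t - t') • v'‖ ^ ((1 : ℝ) / 3) ≤ ρ := by
    rw [hρ]; exact (le_max_left _ _).trans (le_max_right _ _)
  have ρ3 : ‖v - v'‖ ≤ ρ := by
    rw [hρ]; exact (le_max_right _ _).trans (le_max_right _ _)
  have ρ0 : 0 ≤ ρ := (norm_nonneg _).trans ρ3
  rw [← hρ]
  have hρα : 0 ≤ ρ ^ α := by positivity
  have hMδ : 0 ≤ 2 * M / δ₀ ^ α := by positivity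
  by_cases hfar : δ₀ ^ 2 < |t - t'|
  · have h1 : δ₀ ≤ ρ := by
      refine le_trans ?_ ρ1
      calc δ₀ = (δ₀ ^ 2) ^ ((1 : ℝ) / 2) := by
            rw [← Real.sqrt_eq_rpow, Real.sqrt_sq hδ₀.le]
        _ ≤ _ := by gcongr
    calc ‖g (t, x, v) - g (t', x', v')‖ ≤ M + M :=
          (norm_sub_le _ _).trans (add_le_add (hM hz) (hM hz'))
      _ = 2 * M / δ₀ ^ α * δ₀ ^ α := by
          rw [div_mul_cancel₀ _ (by positivity)]; ring
      _ ≤ (A + 2 * K + 2 * M / δ₀ ^ α) * ρ ^ α := by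
          gcongr
          linarith
  · rw [not_lt] at hfar
    obtain ⟨w, hw⟩ : ∃ w, w = x' - (t - t') • v' := ⟨_, rfl⟩
    have nw : ‖w‖ < r ^ 3 + δ₀ ^ 2 * r := by
      have : ‖(t - t') • v'‖ ≤ δ₀ ^ 2 * r := by
        rw [norm_smul, Real.norm_eq_abs]; gcongr
      rw [hw]; linarith [norm_sub_le x' ((t - t') • v')]
    have hδr : 0 < δ₀ ^ 2 * r := by positivity
    have e1 : ‖g (t, x, v) - g (t, w, v')‖ ≤ 2 * K * ρ ^ α := by
      refine (hK (mem_prodCyl.2 ⟨⟨by linarith, ht0⟩, by linarith, by linarith⟩)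
        (mem_prodCyl.2 ⟨⟨by linarith, ht0⟩, by linarith, by linarith⟩)).trans ?_
      rw [show x - w = x - x' + (t - t') • v' by rw [hw]; abel]
      calc _ ≤ K * (2 * ρ) ^ α := by
            gcongr
            linarith
        _ ≤ K * (2 * ρ ^ α) := by
            gcongr
            exact mul_rpow_le_mul_rpow (by norm_num) ρ0 hα1.le
        _ = _ := by ring
    have e2 : ‖g (t, w, v') - g (t', x', v')‖ ≤ A * ρ ^ α := by
      rcases lt_trichotomy t t' with h | h | h
      · have hd : |t - t'| = t' - t := by rw [abs_sub_comm, abs_of_pos (by linarith)]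
        rw [hd] at hfar ρ1
        have := hA (t := t) (h := t' - t) (x := w) (v := v') (by linarith) hfar ht
          (by linarith) nw hv'
        rw [add_sub_cancel, show w - (t' - t) • v' = x' by rw [hw]; module] at this
        rw [norm_sub_rev]
        refine this.trans ?_
        have : 0 ≤ t' - t := by linarith
        gcongr
      · subst h
        rw [hw, sub_self, zero_smul, sub_zero, sub_self, norm_zero]
        positivity
      · have hd : |t - t'| = t - t' := abs_of_pos (by linarith)
        rw [hd] at hfar ρ1
        have := hA (t := t') (h := t - t') (x := x') (v := v') (by linarith) hfar ht'
          (by linarith) (by linarith) hv'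
        rw [add_sub_cancel, ← hw] at this
        refine this.trans ?_
        have : 0 ≤ t - t' := by linarith
        gcongr
    calc ‖g (t, x, v) - g (t', x', v')‖
        ≤ ‖g (t, x, v) - g (t, w, v')‖ + ‖g (t, w, v') - g (t', x', v')‖ :=
          norm_sub_le_norm_sub_add_norm_sub _ _ _
      _ ≤ 2 * K * ρ ^ α + A * ρ ^ α := add_le_add e1 e2
      _ ≤ _ := by nlinarith

theorem kSemi_le_ofReal {d : ℕ} {F : Type*} [NormedAddCommGroup F] {α C : ℝ} {G : Set (Pt d)}
    {g : Pt d → F} (hC : 0 ≤ C)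
    (h : ∀ z ∈ G, ∀ z' ∈ G, ‖g z - g z'‖ ≤ C * kRho z z' ^ α) :
    kSemi α G g ≤ ENNReal.ofReal C := by
  refine iSup₂_le fun z hz => iSup₂_le fun z' hz' => iSup_le fun _ => ?_
  refine ENNReal.ofReal_le_ofReal (div_le_of_le_mul₀ ?_ hC (h z hz z' hz'))
  exact Real.rpow_nonneg ((Real.rpow_nonneg (abs_nonneg _) _).trans (le_max_left _ _)) _

theorem norm_le_of_supNorm_le {d : ℕ} {F : Type*} [NormedAddCommGroup F] {S : ℝ} {G : Set (Pt d)}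
    {g : Pt d → F} (hS : 0 ≤ S) (h : supNorm G g ≤ ENNReal.ofReal S) {z : Pt d} (hz : z ∈ G) :
    ‖g z‖ ≤ S := by
  have h1 : (‖g z‖₊ : ℝ≥0∞) ≤ ENNReal.ofReal S := (le_iSup₂ (f := fun (z : Pt d) (_ : z ∈ G) =>
    (‖g z‖₊ : ℝ≥0∞)) z hz).trans h
  rw [← ENNReal.ofReal_le_ofReal_iff hS]
  exact (ofReal_norm (g z)).trans_le h1

theorem norm_sub_le_of_lixvSemi_le {d : ℕ} {F : Type*} [NormedAddCommGroup F] {α S R : ℝ}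
    {g : Pt d → F} (hS : 0 ≤ S)
    (h : lixvSemi α (Set.Ioo (-(R ^ 2)) 0)
      (Metric.ball (0 : Ed d) (R ^ 3) ×ˢ Metric.ball (0 : Ed d) R) g ≤ ENNReal.ofReal S)
    {t : ℝ} {x v x' v' : Ed d} (hm : (t, x, v) ∈ prodCyl d R) (hm' : (t, x', v') ∈ prodCyl d R) :
    ‖g (t, x, v) - g (t, x', v')‖ ≤ S * (‖x - x'‖ ^ ((1 : ℝ) / 3) + ‖v - v'‖) ^ α := by
  by_cases hne : (x, v) = (x', v')
  · obtain ⟨rfl, rfl⟩ := Prod.mk.inj hne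
    rw [sub_self (g _), norm_zero]
    positivity
  have h1 : ENNReal.ofReal (‖g (t, x, v) - g (t, x', v')‖ /
      (‖x - x'‖ ^ ((1 : ℝ) / 3) + ‖v - v'‖) ^ α) ≤ ENNReal.ofReal S := by
    refine le_trans ?_ h
    refine le_iSup₂_of_le t hm.1 ?_
    refine le_iSup₂_of_le (x, v) hm.2 ?_
    refine le_iSup₂_of_le (x', v') hm'.2 ?_
    exact le_iSup_of_le hne le_rfl
  rw [ENNReal.ofReal_le_ofReal_iff hS, div_le_iff₀] at h1
  · exact h1
  · refine Real.rpow_pos_of_pos ?_ _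
    by_cases hx : x = x'
    · have : 0 < ‖v - v'‖ := norm_sub_pos_iff.2 fun hv => hne (by rw [hx, hv])
      positivity
    · have : 0 < ‖x - x'‖ := norm_sub_pos_iff.2 hx
      positivity

theorem supNorm_mono {d : ℕ} {F : Type*} [NormedAddCommGroup F] {G G' : Set (Pt d)}
    {g : Pt d → F} (h : G ⊆ G') : supNorm G g ≤ supNorm G' g :=
  biSup_mono h

theorem lixvSemi_mono {d : ℕ} {F : Type*} [NormedAddCommGroup F] {α : ℝ} {I I' : Set ℝ}
    {D D' : Set (Ed d × Ed d)} {g : Pt d → F} (hI : I ⊆ I') (hD : D ⊆ D') :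
    lixvSemi α I D g ≤ lixvSemi α I' D' g :=
  iSup_mono fun _ => iSup_mono' fun ht => ⟨hI ht, iSup_mono fun _ => iSup_mono' fun hp => ⟨hD hp,
    iSup_mono fun _ => iSup_mono' fun hq => ⟨hD hq, le_rfl⟩⟩⟩

namespace AnisoBound

variable {d : ℕ} {α S R : ℝ} {u : Pt d → ℝ} {t h : ℝ} {x v : Ed d}

theorem Dvv_symm (H : AnisoBound α S R u) (hm : (t, x, v) ∈ prodCyl d R) (a b : Ed d) :
    Dvv u (t, x, v) a b = Dvv u (t, x, v) b a := by
  have hm' := mem_prodCyl.1 hm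
  have hball : ∀ w ∈ Metric.ball (0 : Ed d) R, (t, x, w) ∈ prodCyl d R := fun w hw =>
    mem_prodCyl.2 ⟨hm'.1, hm'.2.1, mem_ball_zero_iff.1 hw⟩
  refine second_derivative_symmetric_of_eventually (f := fun w => u (t, x, w))
    (f' := fun w => Dv u (t, x, w)) (x := v) ?_ (H.dvv hm).hasFDerivAt a b
  filter_upwards [Metric.isOpen_ball.mem_nhds (mem_ball_zero_iff.2 hm'.2.2)] with w hw
  exact (H.dv (hball w hw)).hasFDerivAt

theorem norm_Dvv_flow_le (H : AnisoBound α S R u) (hα : 0 < α) (hα1 : α < 1) (hS : 0 ≤ S)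
    {δ₀ : ℝ} (hδ₀ : 0 < δ₀) (hδ1 : δ₀ ≤ 1) (hh : 0 < h) (hhδ : h ≤ δ₀ ^ 2)
    (ht : -(R ^ 2) < t - δ₀ ^ 2) (hth : t + h < 0)
    (hx : ‖x‖ + (5 * R + 3) * δ₀ < R ^ 3) (hv : ‖v‖ + 3 * δ₀ < R) :
    ‖Dvv u (t + h, x - h • v, v) - Dvv u (t, x, v)‖ ≤
      2 * ((4 * spaceConst α δ₀ + 300) * S) * (h ^ ((1 : ℝ) / 2)) ^ α := by
  obtain ⟨δ, hδ, rfl⟩ : ∃ δ > 0, h = δ ^ 2 :=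
    ⟨√h, Real.sqrt_pos.2 hh, (Real.sq_sqrt hh.le).symm⟩
  have hδδ : δ ≤ δ₀ := le_of_pow_le_pow_left₀ (by norm_num) hδ₀.le hhδ
  have hR : 0 < R := by linarith [norm_nonneg v]
  have hRδ : δ ^ 2 * R ≤ δ₀ * R := by
    gcongr
    nlinarith
  have q2 : 0 < δ₀ ^ 2 := by positivity
  have hc := spaceConst_nonneg hα1 hδ₀
  have nv : ‖v‖ < R := by linarith
  have hRδ₀ : 0 < R * δ₀ := by positivity
  have hy : ‖x - δ ^ 2 • v‖ < R ^ 3 := by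
    have : ‖δ ^ 2 • v‖ ≤ δ₀ * R := by
      rw [norm_smul, Real.norm_of_nonneg hh.le]
      exact (mul_le_mul_of_nonneg_left nv.le hh.le).trans hRδ
    linarith [norm_sub_le x (δ ^ 2 • v)]
  have m1 : (t, x, v) ∈ prodCyl d R :=
    mem_prodCyl.2 ⟨⟨by linarith, by linarith⟩, by linarith, nv⟩
  have m2 : (t + δ ^ 2, x - δ ^ 2 • v, v) ∈ prodCyl d R :=
    mem_prodCyl.2 ⟨⟨by linarith, hth⟩, hy, nv⟩
  have := opNorm_le_of_symm_of_quadratic_le (C := (4 * spaceConst α δ₀ + 300) * (S * δ ^ α))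
    (L := Dvv u (t + δ ^ 2, x - δ ^ 2 • v, v) - Dvv u (t, x, v)) (by positivity)
    (fun a b => by
      simp only [_root_.sub_apply]
      rw [H.Dvv_symm m1 a b, H.Dvv_symm m2 a b])
    (fun ξ hξ => by
      simp only [_root_.sub_apply]
      exact H.Dvv_flow_apply_le hα hα1 hS hδ hδδ hδ1 hξ rfl ht hth hx hv)
  refine this.trans_eq ?_
  rw [← Real.sqrt_eq_rpow, Real.sqrt_sq hδ.le]
  ring

theorem flow_le_rpow (H : AnisoBound α S R u) (hα : 0 < α) (hα1 : α < 1) (hS : 0 ≤ S)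
    (hh : 0 < h) (hh1 : h ≤ 1) (ht : -(R ^ 2) < t) (hth : t + h < 0)
    (hx : ‖x‖ + 2 * h * ‖v‖ < R ^ 3) (hv : ‖v‖ < R) :
    ‖u (t + h, x - h • v, v) - u (t, x, v)‖ ≤ S * (h ^ ((1 : ℝ) / 2)) ^ α := by
  refine (H.flow_le hα hh ht hth hx hv).trans ?_
  gcongr
  rw [← Real.rpow_mul hh.le]
  exact Real.self_le_rpow_of_le_one hh.le hh1 (by linarith)

end AnisoBound

theorem C2mem.anisoBound {d : ℕ} {α S R : ℝ} {u : Pt d → ℝ} (hS : 0 ≤ S)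
    (hu : C2mem α (Set.Ioo (-(R ^ 2)) 0)
      (Metric.ball (0 : Ed d) (R ^ 3) ×ˢ Metric.ball (0 : Ed d) R) u)
    (h1 : supNorm (prodCyl d R) u ≤ ENNReal.ofReal S)
    (h2 : lixvSemi α (Set.Ioo (-(R ^ 2)) 0)
      (Metric.ball (0 : Ed d) (R ^ 3) ×ˢ Metric.ball (0 : Ed d) R) u ≤ ENNReal.ofReal S)
    (h3 : supNorm (prodCyl d R) (Dv u) ≤ ENNReal.ofReal S)
    (h4 : supNorm (prodCyl d R) (Dvv u) ≤ ENNReal.ofReal S)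
    (h5 : lixvSemi α (Set.Ioo (-(R ^ 2)) 0)
      (Metric.ball (0 : Ed d) (R ^ 3) ×ˢ Metric.ball (0 : Ed d) R) (Dvv u) ≤ ENNReal.ofReal S)
    (h6 : supNorm (prodCyl d R) (Yop u) ≤ ENNReal.ofReal S)
    (h7 : lixvSemi α (Set.Ioo (-(R ^ 2)) 0)
      (Metric.ball (0 : Ed d) (R ^ 3) ×ˢ Metric.ball (0 : Ed d) R) (Yop u) ≤ ENNReal.ofReal S) :
    AnisoBound α S R u where
  dt hm := hu.1 _ hm
  dx hm := hu.2.1 _ hm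
  dv hm := hu.2.2.1 _ hm
  dvv hm := hu.2.2.2.1 _ hm
  u_le hm := norm_le_of_supNorm_le hS h1 hm
  Dv_le hm := norm_le_of_supNorm_le hS h3 hm
  Dvv_le hm := norm_le_of_supNorm_le hS h4 hm
  Y_le hm := norm_le_of_supNorm_le hS h6 hm
  u_holder hm hm' := norm_sub_le_of_lixvSemi_le hS h2 hm hm'
  Dvv_holder hm hm' := norm_sub_le_of_lixvSemi_le hS h5 hm hm'
  Y_holder hm hm' := norm_sub_le_of_lixvSemi_le hS h7 hm hm'

theorem exists_interior_scale {r R : ℝ} (hr : 0 < r) (hrR : r < R) :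
    ∃ δ : ℝ, 0 < δ ∧ δ ≤ 1 ∧ r + 3 * δ < R ∧
      r ^ 3 + 3 * δ ^ 2 * r + (5 * R + 3) * δ < R ^ 3 ∧ r ^ 2 + δ ^ 2 < R ^ 2 := by
  have h1 : ∀ᶠ δ : ℝ in nhds 0, δ < 1 := eventually_lt_nhds one_pos
  have h2 : ∀ᶠ δ : ℝ in nhds 0, r + 3 * δ < R :=
    ContinuousAt.eventually_lt (by fun_prop) (by fun_prop) (by simpa using hrR)
  have h3 : ∀ᶠ δ : ℝ in nhds 0, r ^ 3 + 3 * δ ^ 2 * r + (5 * R + 3) * δ < R ^ 3 :=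
    ContinuousAt.eventually_lt (by fun_prop) (by fun_prop) (by
      simpa using pow_lt_pow_left₀ hrR hr.le (by norm_num : 3 ≠ 0))
  have h4 : ∀ᶠ δ : ℝ in nhds 0, r ^ 2 + δ ^ 2 < R ^ 2 :=
    ContinuousAt.eventually_lt (by fun_prop) (by fun_prop) (by
      simpa using pow_lt_pow_left₀ hrR hr.le (by norm_num : 2 ≠ 0))
  have h := (h1.and (h2.and (h3.and h4))).filter_mono (nhdsWithin_le_nhds (s := Set.Ioi 0))
  obtain ⟨δ, ⟨a, b, c, e⟩, hδ⟩ := (h.and self_mem_nhdsWithin).exists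
  exact ⟨δ, hδ, a.le, b, c, e⟩

/-- Kinetic Hölder bounds for `u` and `D²_v u` on the smaller cylinder. -/
theorem AnisoBound.kSemi_le {d : ℕ} {α S r R δ₀ : ℝ} {u : Pt d → ℝ} (H : AnisoBound α S R u)
    (hα : 0 < α) (hα1 : α < 1) (hS : 0 ≤ S) (hr : 0 < r) (hδ₀ : 0 < δ₀) (hδ1 : δ₀ ≤ 1)
    (h1 : r + 3 * δ₀ < R) (h3 : r ^ 3 + 3 * δ₀ ^ 2 * r + (5 * R + 3) * δ₀ < R ^ 3)
    (h2 : r ^ 2 + δ₀ ^ 2 < R ^ 2) :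
    kSemi α (prodCyl d r) u ≤ ENNReal.ofReal (S + 2 * S + 2 * S / δ₀ ^ α) ∧
    kSemi α (prodCyl d r) (Dvv u) ≤ ENNReal.ofReal
      (2 * ((4 * spaceConst α δ₀ + 300) * S) + 2 * S + 2 * S / δ₀ ^ α) := by
  have hc := spaceConst_nonneg hα1 hδ₀
  have hR : 0 < R := by linarith
  have q1 : 0 < R * δ₀ := by positivity
  have q2 : 0 < δ₀ ^ 2 := by positivity
  have q3 : 0 < δ₀ ^ 2 * r := by positivity
  have hδ2 : δ₀ ^ 2 ≤ 1 := pow_le_one₀ hδ₀.le hδ1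
  have hsub : ∀ {t : ℝ} {x v : Ed d}, (t, x, v) ∈ prodCyl d r → (t, x, v) ∈ prodCyl d R := by
    intro t x v hm
    obtain ⟨⟨a, b⟩, c, e⟩ := mem_prodCyl.1 hm
    exact mem_prodCyl.2 ⟨⟨by linarith, b⟩, by linarith, by linarith⟩
  constructor
  · refine kSemi_le_ofReal (by positivity) fun z hz z' hz' => norm_sub_le_kRho_rpow hα hα1 hδ₀
      (by linarith) (by linarith) (by linarith) hS hS hS (fun hm => H.u_le (hsub hm))
      H.u_holder (fun {t h x v} hh hhδ ht hth hx hv => ?_) hz hz'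
    refine H.flow_le_rpow hα hα1 hS hh (by linarith) (by linarith) hth ?_ (by linarith)
    have : h * ‖v‖ ≤ δ₀ ^ 2 * r := by gcongr
    linarith
  · refine kSemi_le_ofReal (by positivity) fun z hz z' hz' => norm_sub_le_kRho_rpow hα hα1 hδ₀
      (by linarith) (by linarith) (by linarith) hS hS (by positivity)
      (fun hm => H.Dvv_le (hsub hm)) H.Dvv_holder
      (fun {t h x v} hh hhδ ht hth hx hv => ?_) hz hz'
    exact H.norm_Dvv_flow_le hα hα1 hS hδ₀ hδ1 hh hhδ (by linarith) hth (by linarith)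
      (by linarith)

open MeasureTheory ENNReal Set in
/-- **Corollary 1.8 (ii)**: local inclusion of `ℂ^{2,α}(Q_R)` into `kC^{2,α}(Q_r)`. -/
theorem C2_subset_kC2_local (d : ℕ) (hd : 1 ≤ d) (α : ℝ) (hα : α ∈ Set.Ioo (0:ℝ) 1)
    (R : ℝ) (hR : 0 < R) :
    ∀ r : ℝ, 0 < r → r < R → ∃ N : ℝ, 0 < N ∧
      ∀ u : Pt d → ℝ,
        C2mem α (Set.Ioo (-(R ^ 2)) 0)
          (Metric.ball (0 : Ed d) (R ^ 3) ×ˢ Metric.ball (0 : Ed d) R) u →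
        kC2mem α (Set.Ioo (-(r ^ 2)) 0)
          (Metric.ball (0 : Ed d) (r ^ 3) ×ˢ Metric.ball (0 : Ed d) r) u ∧
        kSemi α (Set.Ioo (-(r ^ 2)) 0 ×ˢ
            (Metric.ball (0 : Ed d) (r ^ 3) ×ˢ Metric.ball (0 : Ed d) r)) (Dvv u) ≤
          ENNReal.ofReal N *
            ((supNorm (Set.Ioo (-(R ^ 2)) 0 ×ˢ
                (Metric.ball (0 : Ed d) (R ^ 3) ×ˢ Metric.ball (0 : Ed d) R)) u +
              lixvSemi α (Set.Ioo (-(R ^ 2)) 0)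
                (Metric.ball (0 : Ed d) (R ^ 3) ×ˢ Metric.ball (0 : Ed d) R) u) +
             (supNorm (Set.Ioo (-(R ^ 2)) 0 ×ˢ
                (Metric.ball (0 : Ed d) (R ^ 3) ×ˢ Metric.ball (0 : Ed d) R)) (Dv u) +
              lixvSemi α (Set.Ioo (-(R ^ 2)) 0)
                (Metric.ball (0 : Ed d) (R ^ 3) ×ˢ Metric.ball (0 : Ed d) R) (Dv u)) +
             (supNorm (Set.Ioo (-(R ^ 2)) 0 ×ˢ
                (Metric.ball (0 : Ed d) (R ^ 3) ×ˢ Metric.ball (0 : Ed d) R)) (Dvv u) +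
              lixvSemi α (Set.Ioo (-(R ^ 2)) 0)
                (Metric.ball (0 : Ed d) (R ^ 3) ×ˢ Metric.ball (0 : Ed d) R) (Dvv u)) +
             (supNorm (Set.Ioo (-(R ^ 2)) 0 ×ˢ
                (Metric.ball (0 : Ed d) (R ^ 3) ×ˢ Metric.ball (0 : Ed d) R)) (Yop u) +
              lixvSemi α (Set.Ioo (-(R ^ 2)) 0)
                (Metric.ball (0 : Ed d) (R ^ 3) ×ˢ Metric.ball (0 : Ed d) R) (Yop u))) := by
  intro r hr hrR
  obtain ⟨δ₀, hδ₀, hδ1, e1, e3, e2⟩ := exists_interior_scale hr hrR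
  have hc := AnisoBound.spaceConst_nonneg (α := α) hα.2 hδ₀
  refine ⟨2 * (4 * AnisoBound.spaceConst α δ₀ + 300) + 2 + 2 / δ₀ ^ α, by positivity, fun u hu => ?_⟩
  obtain ⟨dt, dx, dv, dvv, s1, l1, s2, l2, s3, l3, s4, l4⟩ := id hu
  generalize hW : supNorm _ u + _ + _ + _ + _ = W
  have hWtop : W < ⊤ := by
    rw [← hW]
    simp only [ENNReal.add_lt_top]
    exact ⟨⟨⟨⟨s1, l1⟩, s2, l2⟩, s3, l3⟩, s4, l4⟩
  have hS : 0 ≤ W.toReal := ENNReal.toReal_nonneg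
  have hWS : ENNReal.ofReal W.toReal = W := ENNReal.ofReal_toReal hWtop.ne
  have H : AnisoBound α W.toReal R u := by
    refine hu.anisoBound hS ?_ ?_ ?_ ?_ ?_ ?_ ?_ <;> rw [hWS, ← hW]
    · exact le_self_add.trans (le_self_add.trans (le_self_add.trans le_self_add))
    · exact le_add_self.trans (le_self_add.trans (le_self_add.trans le_self_add))
    · exact le_self_add.trans (le_add_self.trans (le_self_add.trans le_self_add))
    · exact le_self_add.trans (le_add_self.trans le_self_add)
    · exact le_add_self.trans (le_add_self.trans le_self_add)
    · exact le_self_add.trans le_add_self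
    · exact le_add_self.trans le_add_self
  obtain ⟨k1, k2⟩ := H.kSemi_le hα.1 hα.2 hS hr hδ₀ hδ1 e1 e3 e2
  have hI : Set.Ioo (-(r ^ 2)) 0 ⊆ Set.Ioo (-(R ^ 2)) 0 :=
    Set.Ioo_subset_Ioo_left (by linarith [pow_pos hδ₀ 2])
  have hD : Metric.ball (0 : Ed d) (r ^ 3) ×ˢ Metric.ball (0 : Ed d) r ⊆
      Metric.ball (0 : Ed d) (R ^ 3) ×ˢ Metric.ball (0 : Ed d) R :=
    Set.prod_mono (Metric.ball_subset_ball (by gcongr)) (Metric.ball_subset_ball hrR.le)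
  have hG := Set.prod_mono hI hD
  refine ⟨⟨(supNorm_mono hG).trans_lt s1, k1.trans_lt ENNReal.ofReal_lt_top,
    fun z hz => dt z (hG hz), fun z hz => dx z (hG hz), fun z hz => dv z (hG hz),
    fun z hz => dvv z (hG hz), (supNorm_mono hG).trans_lt s4, (lixvSemi_mono hI hD).trans_lt l4,
    k2.trans_lt ENNReal.ofReal_lt_top⟩, k2.trans_eq ?_⟩
  conv_rhs => rw [← hWS]
  rw [← ENNReal.ofReal_mul (by positivity)]
  congr 1
  ring
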